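/- Let D ⊆ ℂ be a generalized Jordan domain and let φ : D → Ω be a homeomorphism of D onto a bounded domain Ω ⊆ ℂ. Then φ admits a continuous injective extension φ̄ : closure(D) → closure(Ω) if and only if the following three conditions hold: (1) Ω is a generalized Jordan domain; (2) for every z₀ ∈ ∂D, liminf_{r→0⁺} σ_r(z₀) = 0; (3) the continuous extension φ̄ of φ (which exists under (1) and (2)) is constant on no arc A ⊆ ∂D (homeomorphic image of [0,1]) of positive 1-dimensional Hausdorff measure. -/

import Mathlib

open Set Metric Filter MeasureTheory Topology

noncomputable section

/-- A planar domain: a nonempty open connected subset of ℂ. -/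
def IsPlanarDomain (D : Set ℂ) : Prop := D.Nonempty ∧ IsOpen D ∧ IsConnected D

/-- A Peano compactum: a compact subset of ℂ all of whose connected components are
locally connected (as subspaces of ℂ) and such that for every `C > 0` only finitely
many components have diameter greater than `C`. -/
def IsPeanoCompactum (K : Set ℂ) : Prop :=
  IsCompact K ∧
  (∀ x ∈ K, LocallyConnectedSpace ↥(connectedComponentIn K x)) ∧
  ∀ C : ℝ, 0 < C →
    {Q : Set ℂ | (∃ x ∈ K, Q = connectedComponentIn K x) ∧ C < Metric.diam Q}.Finite

/-- A Jordan curve: a subset of ℂ homeomorphic to the unit circle. -/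
def IsJordanCurve (J : Set ℂ) : Prop :=
  Nonempty (↥J ≃ₜ ↥(Metric.sphere (0:ℂ) 1))

/-- A generalized Jordan domain: a bounded domain whose boundary is a Peano compactum,
each of whose boundary components is a single point or a Jordan curve. -/
def IsGeneralizedJordanDomain (D : Set ℂ) : Prop :=
  IsPlanarDomain D ∧ Bornology.IsBounded D ∧
  IsPeanoCompactum (frontier D) ∧
  ∀ x ∈ frontier D,
    connectedComponentIn (frontier D) x = {x} ∨
    IsJordanCurve (connectedComponentIn (frontier D) x)

/-- `φ` restricts to a homeomorphism of `D` onto `Ω`. -/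
def IsHomeoOnto (φ : ℂ → ℂ) (D Ω : Set ℂ) : Prop :=
  ContinuousOn φ D ∧ Set.BijOn φ D Ω ∧
  ∃ ψ : ℂ → ℂ, ContinuousOn ψ Ω ∧ Set.InvOn ψ φ D Ω

/-- `φ` is a conformal homeomorphism (holomorphic bijection) of `D` onto `Ω`. -/
def IsConformalHomeoOnto (φ : ℂ → ℂ) (D Ω : Set ℂ) : Prop :=
  DifferentiableOn ℂ φ D ∧ Set.BijOn φ D Ω

/-- `φb` is a continuous extension of `φ : D → Ω` to `closure D`, with values in `closure Ω`. -/
def ExtendsContinuously (φ φb : ℂ → ℂ) (D Ω : Set ℂ) : Prop :=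
  ContinuousOn φb (closure D) ∧ Set.EqOn φb φ D ∧ Set.MapsTo φb (closure D) (closure Ω)

/-- The oscDiam `σ_r(z₀) = diam φ(D ∩ C_r(z₀))`. -/
def oscDiam (φ : ℂ → ℂ) (D : Set ℂ) (z₀ : ℂ) (r : ℝ) : ℝ :=
  Metric.diam (φ '' (D ∩ Metric.sphere z₀ r))

/-- `liminf_{r→0⁺} σ_r(z₀) = 0`. -/
def OscLiminfZero (φ : ℂ → ℂ) (D : Set ℂ) (z₀ : ℂ) : Prop :=
  Filter.liminf (oscDiam φ D z₀) (nhdsWithin (0:ℝ) (Set.Ioi 0)) = 0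

/-- A circle domain (normalized so that ∞ lies in a complementary disk): every bounded
complementary component is a point or a closed round disk, and the unbounded
complementary component is the complement of an open round disk. -/
def IsCircleDomain (D : Set ℂ) : Prop :=
  IsPlanarDomain D ∧ Bornology.IsBounded D ∧
  ∀ x ∈ Dᶜ,
    (Bornology.IsBounded (connectedComponentIn Dᶜ x) →
      connectedComponentIn Dᶜ x = {x} ∨
      ∃ c : ℂ, ∃ rad : ℝ, 0 < rad ∧ connectedComponentIn Dᶜ x = Metric.closedBall c rad) ∧
    (¬ Bornology.IsBounded (connectedComponentIn Dᶜ x) →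
      ∃ c : ℂ, ∃ rad : ℝ, 0 < rad ∧ connectedComponentIn Dᶜ x = (Metric.ball c rad)ᶜ)

/-- A set has σ-finite linear (1-dimensional Hausdorff) measure. -/
def SigmaFiniteH1 (E : Set ℂ) : Prop :=
  ∃ f : ℕ → Set ℂ, (⋃ n, f n) = E ∧ ∀ n, μH[1] (f n) < ⊤

/-- The set of connected components of `K` containing more than one point. -/
def NondegComponents (K : Set ℂ) : Set (Set ℂ) :=
  {Q | (∃ x ∈ K, Q = connectedComponentIn K x) ∧ ∃ a ∈ Q, ∃ b ∈ Q, a ≠ b}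

/-- The union of the singleton connected components of `K`. -/
def SingletonPart (K : Set ℂ) : Set ℂ :=
  {x | x ∈ K ∧ connectedComponentIn K x = {x}}

/-- The cluster set `C(h, z₀) = ⋂_{r>0} closure h({z ∈ U : |z − z₀| < r})`. -/
def clusterSet (h : ℂ → ℂ) (U : Set ℂ) (z₀ : ℂ) : Set ℂ :=
  ⋂ r ∈ Set.Ioi (0:ℝ), closure (h '' (U ∩ Metric.ball z₀ r))

/-- The boundary component of `Ω` corresponding (under `φ : D → Ω`) to a boundary
component `Q` of `D`: `φ^B(Q) = ⋃_{z ∈ Q} C(φ, z)`. -/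
def boundaryComp (φ : ℂ → ℂ) (D : Set ℂ) (Q : Set ℂ) : Set ℂ :=
  ⋃ z ∈ Q, clusterSet φ D z

/-- An arc: the image of a continuous injective map from `[0,1]`. -/
def IsArc (A : Set ℂ) : Prop :=
  ∃ f : ℝ → ℂ, ContinuousOn f (Set.Icc 0 1) ∧ Set.InjOn f (Set.Icc 0 1) ∧
    f '' Set.Icc 0 1 = A

/-- An arc from `a` to `b`. -/
def IsArcFromTo (A : Set ℂ) (a b : ℂ) : Prop :=
  ∃ f : ℝ → ℂ, ContinuousOn f (Set.Icc 0 1) ∧ Set.InjOn f (Set.Icc 0 1) ∧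
    f '' Set.Icc 0 1 = A ∧ f 0 = a ∧ f 1 = b

/-- Property S: for every `ε > 0`, `Ω` is a finite union of connected sets of diameter `< ε`. -/
def PropertyS (Ω : Set ℂ) : Prop :=
  ∀ ε > (0:ℝ), ∃ (k : ℕ) (N : Fin k → Set ℂ),
    (∀ i, IsConnected (N i) ∧ Metric.diam (N i) < ε) ∧ (⋃ i, N i) = Ω

/-- `x ∈ ∂Ω` is locally accessible from `Ω`. -/
def LocallyAccessible (Ω : Set ℂ) (x : ℂ) : Prop :=
  ∀ ε > (0:ℝ), ∃ δ > (0:ℝ), ∀ z ∈ Ω, dist z x < δ →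
    ∃ A : Set ℂ, IsArcFromTo A z x ∧ A ⊆ Ω ∪ {x} ∧ Metric.diam A < ε

/-- `ξ ∈ ∂Ω` is locally sequentially accessible. -/
def LocallySeqAccessible (Ω : Set ℂ) (ξ : ℂ) : Prop :=
  ∀ r > (0:ℝ), ∀ ξn : ℕ → ℂ, (∀ n, ξn n ∈ Ω) → Filter.Tendsto ξn Filter.atTop (nhds ξ) →
    ∃ x ∈ Ω ∩ Metric.ball ξ r,
      {n : ℕ | ξn n ∈ connectedComponentIn (Ω ∩ Metric.ball ξ r) x}.Infinite

/-- `Ω` is finitely connected at the boundary point `x`. -/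
def FinitelyConnectedAt (Ω : Set ℂ) (x : ℂ) : Prop :=
  ∀ r > (0:ℝ), ∃ U : Set ℂ, IsOpen U ∧ x ∈ U ∧ U ⊆ Metric.ball x r ∧
    {Q : Set ℂ | ∃ y ∈ U ∩ Ω, Q = connectedComponentIn (U ∩ Ω) y}.Finite

/-- The diameter (Mazurkiewicz) distance on `Ω`. -/
def mazDist (Ω : Set ℂ) (x y : ℂ) : ℝ :=
  sInf (Metric.diam '' {E : Set ℂ | E ⊆ Ω ∧ IsConnected E ∧ x ∈ E ∧ y ∈ E})

/-- `Ω` is totally bounded for the Mazurkiewicz distance; for a metric space this is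
equivalent to compactness of the metric completion of `(Ω, mazDist)`. -/
def MazCompletionCompact (Ω : Set ℂ) : Prop :=
  ∀ ε > (0:ℝ), ∃ F : Finset ℂ, ↑F ⊆ Ω ∧ ∀ x ∈ Ω, ∃ y ∈ F, mazDist Ω x y < ε

/-- `f : A → B` is non-alternating: there are no `x, y ∈ B` and no separation of
`A \ f⁻¹({x})` into two disjoint nonempty relatively open sets `A₁, A₂` with
`y ∈ f(A₁) ∩ f(A₂)`. -/
def NonAlternatingOn (f : ℂ → ℂ) (A B : Set ℂ) : Prop :=
  ¬ ∃ x ∈ B, ∃ y ∈ B, ∃ A₁ A₂ : Set ℂ,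
      A₁.Nonempty ∧ A₂.Nonempty ∧ Disjoint A₁ A₂ ∧
      A₁ ∪ A₂ = {z | z ∈ A ∧ f z ≠ x} ∧
      (∃ U₁ : Set ℂ, IsOpen U₁ ∧ A₁ = U₁ ∩ {z | z ∈ A ∧ f z ≠ x}) ∧
      (∃ U₂ : Set ℂ, IsOpen U₂ ∧ A₂ = U₂ ∩ {z | z ∈ A ∧ f z ≠ x}) ∧
      y ∈ f '' A₁ ∧ y ∈ f '' A₂

/-! ### Continuous logarithms and planar separation -/

/-- Two points of a preconnected set missing the closed set `K` admit a continuous branch of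
`log ((z - x) / (z - y))` on `K`. -/
theorem exists_log_of_isPreconnected {K C : Set ℂ} (hK : IsClosed K) (hC : IsPreconnected C)
    (hCK : Disjoint C K) {x y : ℂ} (hx : x ∈ C) (hy : y ∈ C) :
    ∃ L : ℂ → ℂ, ContinuousOn L K ∧ ∀ z ∈ K, Complex.exp (L z) = (z - x) / (z - y) := by
  have hne : ∀ u ∈ C, ∀ z ∈ K, z - u ≠ 0 := fun u hu z hz h =>
    Set.disjoint_left.1 hCK hu (sub_eq_zero.1 h ▸ hz)
  refine hC.induction₂ (fun x y => ∃ L : ℂ → ℂ, ContinuousOn L K ∧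
    ∀ z ∈ K, Complex.exp (L z) = (z - x) / (z - y)) ?_ ?_ ?_ hx hy
  · intro x hx
    have hxK : x ∈ Kᶜ := Set.disjoint_left.1 hCK hx
    obtain ⟨ε, hε, hball⟩ := Metric.isOpen_iff.1 hK.isOpen_compl x hxK
    filter_upwards [mem_nhdsWithin_of_mem_nhds (Metric.ball_mem_nhds x (half_pos hε)),
      self_mem_nhdsWithin] with y hy hyC
    have hslit : ∀ z ∈ K, (z - x) / (z - y) ∈ Complex.slitPlane := by
      intro z hz
      have h1 : ε ≤ dist z x := not_lt.1 fun h => hball h hz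
      have h2 : dist y x < ε / 2 := hy
      have h3 := dist_triangle z y x
      have h4 : dist y x < dist z y := by linarith
      apply Complex.mem_slitPlane_of_norm_lt_one (z := (z - x) / (z - y) - 1) _ |> fun h => by
        simpa using h
      have : (z - x) / (z - y) - 1 = (y - x) / (z - y) := by
        field_simp [hne y hyC z hz]
        ring
      rw [this, norm_div, div_lt_one (norm_pos_iff.2 (hne y hyC z hz)), ← dist_eq_norm,
        ← dist_eq_norm]
      exact h4
    refine ⟨fun z => Complex.log ((z - x) / (z - y)), ?_, fun z hz =>
      Complex.exp_log (Complex.slitPlane_ne_zero (hslit z hz))⟩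
    exact ContinuousOn.clog ((continuousOn_id.sub continuousOn_const).div
      (continuousOn_id.sub continuousOn_const) (hne y hyC)) hslit
  · rintro x y w hx hy hw ⟨L, hL, hL'⟩ ⟨M, hM, hM'⟩
    refine ⟨fun z => L z + M z, hL.add hM, fun z hz => ?_⟩
    rw [Complex.exp_add, hL' z hz, hM' z hz]
    field_simp [hne y hy z hz, hne w hw z hz]
  · rintro x y hx hy ⟨L, hL, hL'⟩
    refine ⟨fun z => -L z, hL.neg, fun z hz => ?_⟩
    rw [Complex.exp_neg, hL' z hz, inv_div]

/-- Two continuous logarithms of the same function on a preconnected set differ by a constant. -/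
theorem sub_eq_sub_of_exp_eq {X : Type*} [TopologicalSpace X] {S : Set X} (hS : IsPreconnected S)
    {f g : X → ℂ} (hf : ContinuousOn f S) (hg : ContinuousOn g S)
    (h : ∀ z ∈ S, Complex.exp (f z) = Complex.exp (g z)) {x y : X} (hx : x ∈ S) (hy : y ∈ S) :
    f x - g x = f y - g y := by
  have key : ∀ z ∈ S, ∃ n : ℤ, f z - g z = n * (2 * Real.pi * Complex.I) := by
    intro z hz
    obtain ⟨n, hn⟩ := Complex.exp_eq_exp_iff_exists_int.1 (h z hz)
    exact ⟨n, by rw [hn]; ring⟩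
  choose! n hn using key
  have hnc : ContinuousOn n S := by
    rw [Int.isClosedEmbedding_coe_real.isEmbedding.continuousOn_iff]
    have h1 : ContinuousOn (fun z => ((f z - g z) / (2 * Real.pi * Complex.I)).re) S :=
      Complex.continuous_re.comp_continuousOn ((hf.sub hg).div_const _)
    refine h1.congr fun z hz => ?_
    simp only [Function.comp_apply]
    rw [hn z hz, mul_div_cancel_right₀ _ Complex.two_pi_I_ne_zero]
    simp
  rw [hn x hx, hn y hy, hS.constant hnc hx hy]

/-- There is no continuous logarithm of `z - x` on a circle centred at `x`. -/
theorem not_exists_log_on_sphere (x : ℂ) {R : ℝ} (hR : 0 < R) (h : ℂ → ℂ)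
    (hc : ContinuousOn h (Metric.sphere x R))
    (he : ∀ z ∈ Metric.sphere x R, Complex.exp (h z) = z - x) : False := by
  set g : ℝ → ℂ := fun θ => h (circleMap x R θ) - θ * Complex.I with hg
  have hgc : Continuous g := by
    have : Continuous fun θ : ℝ => h (circleMap x R θ) :=
      hc.comp_continuous (continuous_circleMap x R) fun θ => circleMap_mem_sphere x hR.le θ
    exact this.sub (by fun_prop)
  have hexp : ∀ θ, Complex.exp (g θ) = R := by
    intro θ
    rw [hg]
    simp only
    rw [Complex.exp_sub, he _ (circleMap_mem_sphere x hR.le θ), circleMap]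
    simp
  have hconst : g (2 * Real.pi) - Complex.log R = g 0 - Complex.log R :=
    sub_eq_sub_of_exp_eq isPreconnected_univ hgc.continuousOn continuousOn_const
      (fun θ _ => by rw [hexp, Complex.exp_log (by exact_mod_cast hR.ne')])
      (Set.mem_univ _) (Set.mem_univ _)
  rw [hg] at hconst
  simp only [circleMap] at hconst
  simp [Complex.exp_two_pi_mul_I] at hconst

theorem isPreconnected_compl_ball_zero (R : ℝ) : IsPreconnected {z : ℂ | R ≤ ‖z‖} := by
  rcases le_or_gt R 0 with hR | hR
  · have : {z : ℂ | R ≤ ‖z‖} = Set.univ := Set.eq_univ_of_forall fun z => hR.trans (norm_nonneg z)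
    rw [this]
    exact isPreconnected_univ
  have : {z : ℂ | R ≤ ‖z‖} =
      (fun p : ℝ × ℝ => (p.1 : ℂ) * Complex.exp (p.2 * Complex.I)) '' (Set.Ici R ×ˢ Set.univ) := by
    ext z
    simp only [Set.mem_ofPred_eq, Set.mem_image, Set.mem_prod, Set.mem_Ici, Set.mem_univ, and_true,
      Prod.exists]
    constructor
    · intro h
      exact ⟨‖z‖, z.arg, h, Complex.norm_mul_exp_arg_mul_I z⟩
    · rintro ⟨r, θ, hr, rfl⟩
      rw [norm_mul, Complex.norm_exp_ofReal_mul_I, Complex.norm_real, mul_one]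
      exact hr.trans (le_abs_self r)
  rw [this]
  exact (isPreconnected_Ici.prod isPreconnected_univ).image _ (by fun_prop)

/-- If `(z - x) / (z - y)` has a continuous logarithm on the compact set `K`, then the component
of `x` in the complement of `K` is not bounded unless it contains `y`. -/
theorem mem_connectedComponentIn_compl_of_log_of_isBounded {K : Set ℂ} (hK : IsCompact K) {x y : ℂ}
    (hx : x ∉ K) (hy : y ∉ K) (hb : Bornology.IsBounded (connectedComponentIn Kᶜ x))
    (L : ℂ → ℂ) (hL : ContinuousOn L K)
    (hexp : ∀ z ∈ K, Complex.exp (L z) = (z - x) / (z - y)) :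
    y ∈ connectedComponentIn Kᶜ x := by
  by_contra hyU
  set U := connectedComponentIn Kᶜ x with hU
  have hUo : IsOpen U := hK.isClosed.isOpen_compl.connectedComponentIn
  have hxU : x ∈ U := mem_connectedComponentIn hx
  have hclos : closure U ⊆ U ∪ K := by
    intro z hz
    by_contra hcon
    simp only [Set.mem_union, not_or] at hcon
    have h1 : IsOpen (connectedComponentIn Kᶜ z) := hK.isClosed.isOpen_compl.connectedComponentIn
    obtain ⟨w, hw1, hw2⟩ := mem_closure_iff.1 hz _ h1 (mem_connectedComponentIn hcon.2)
    have h2 := connectedComponentIn_eq hw1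
    have h3 := connectedComponentIn_eq hw2
    exact hcon.1 (hU ▸ h3 ▸ h2 ▸ mem_connectedComponentIn hcon.2)
  have hfr : frontier U ⊆ K := by
    intro z hz
    rw [hUo.frontier_eq] at hz
    exact (hclos hz.1).resolve_left hz.2
  obtain ⟨G, hG⟩ := ContinuousMap.exists_restrict_eq hK.isClosed
    (⟨K.domRestrict L, continuousOn_iff_continuous_domRestrict.1 hL⟩ : C(K, ℂ))
  have hG' : ∀ z ∈ K, G z = L z := fun z hz => by
    have := congrArg (fun f : C(K, ℂ) => f ⟨z, hz⟩) hG
    simpa using this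
  classical
  set f : ℂ → ℂ := (closure U).piecewise (fun z => Complex.exp (G z) * (z - y)) fun z => z - x
  have hne : ∀ z ∈ K, z - y ≠ 0 := fun z hz h => hy (sub_eq_zero.1 h ▸ hz)
  have hfc : Continuous f := by
    refine continuous_piecewise (fun z hz => ?_) (by fun_prop) (by fun_prop)
    have hzK : z ∈ K := hfr (frontier_closure_subset hz)
    rw [hG' z hzK, hexp z hzK, div_mul_cancel₀ _ (hne z hzK)]
  have hf1 : ∀ z ∈ closure U, f z = Complex.exp (G z) * (z - y) := fun z hz =>
    Set.piecewise_eq_of_mem _ _ _ hz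
  have hf2 : ∀ z ∉ closure U, f z = z - x := fun z hz => Set.piecewise_eq_of_notMem _ _ _ hz
  have hf0 : ∀ z, f z ≠ 0 := by
    intro z
    by_cases hz : z ∈ closure U
    · rw [hf1 z hz]
      refine mul_ne_zero (Complex.exp_ne_zero _) fun h => ?_
      rw [sub_eq_zero.1 h] at hz
      exact (hclos hz).elim hyU hy
    · rw [hf2 z hz]
      exact fun h => hz (subset_closure (sub_eq_zero.1 h ▸ hxU))
  obtain ⟨h, ⟨-, hh⟩, -⟩ := Complex.isCoveringMapOn_exp.existsUnique_continuousMap_lifts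
    (⟨f, hfc⟩ : C(ℂ, ℂ)) (a₀ := 0) (e₀ := Complex.log (f 0)) (Complex.exp_log (hf0 0)) hf0
  obtain ⟨R, hR0, hR⟩ : ∃ R : ℝ, 0 < R ∧ closure U ⊆ Metric.ball x R := by
    obtain ⟨R, hR⟩ := hb.closure.subset_ball x
    exact ⟨max R 1, by positivity, hR.trans (Metric.ball_subset_ball (le_max_left _ _))⟩
  refine not_exists_log_on_sphere x hR0 h h.continuous.continuousOn fun z hz => ?_
  have hzU : z ∉ closure U := fun hcl => by
    have h1 : dist z x < R := hR hcl
    exact absurd (Metric.mem_sphere.1 hz) h1.ne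
  rw [← hf2 z hzU]
  exact congrFun hh z

/-- Eilenberg's criterion: a compact set carrying a continuous logarithm of `(z - x) / (z - y)`
does not separate `x` from `y`. -/
theorem mem_connectedComponentIn_compl_of_log {K : Set ℂ} (hK : IsCompact K) {x y : ℂ}
    (hx : x ∉ K) (hy : y ∉ K) (L : ℂ → ℂ) (hL : ContinuousOn L K)
    (hexp : ∀ z ∈ K, Complex.exp (L z) = (z - x) / (z - y)) :
    y ∈ connectedComponentIn Kᶜ x := by
  by_cases hbx : Bornology.IsBounded (connectedComponentIn Kᶜ x)
  · exact mem_connectedComponentIn_compl_of_log_of_isBounded hK hx hy hbx L hL hexp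
  by_cases hby : Bornology.IsBounded (connectedComponentIn Kᶜ y)
  · have := mem_connectedComponentIn_compl_of_log_of_isBounded hK hy hx hby (fun z => -L z) hL.neg
      fun z hz => by rw [Complex.exp_neg, hexp z hz, inv_div]
    rw [← connectedComponentIn_eq this]
    exact mem_connectedComponentIn hy
  obtain ⟨R, hR⟩ := hK.isBounded.subset_ball (0 : ℂ)
  have hout : {z : ℂ | R ≤ ‖z‖} ⊆ Kᶜ := fun z hz hzK => by
    have h1 := hR hzK
    rw [mem_ball_zero_iff] at h1
    exact absurd hz (not_le.2 h1)
  have hmeet : ∀ w, ¬ Bornology.IsBounded (connectedComponentIn Kᶜ w) →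
      ∃ z ∈ connectedComponentIn Kᶜ w, z ∈ {z : ℂ | R ≤ ‖z‖} := by
    intro w hw
    by_contra! hcon
    exact hw (Metric.isBounded_ball (x := (0 : ℂ)) (r := R) |>.subset fun z hz => by
      simpa using hcon z hz)
  obtain ⟨a, ha, haR⟩ := hmeet x hbx
  obtain ⟨b, hb, hbR⟩ := hmeet y hby
  have hab : b ∈ connectedComponentIn Kᶜ a :=
    (isPreconnected_compl_ball_zero R).subset_connectedComponentIn haR hout hbR
  rw [connectedComponentIn_eq ha, connectedComponentIn_eq hab, ← connectedComponentIn_eq hb]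
  exact mem_connectedComponentIn hy

/-- Janiszewski's theorem: if neither of two compact sets with preconnected intersection
separates `x` from `y`, then neither does their union. -/
theorem exists_isPreconnected_of_union {K₁ K₂ : Set ℂ} (hK₁ : IsCompact K₁) (hK₂ : IsCompact K₂)
    (hK : IsPreconnected (K₁ ∩ K₂)) {C₁ C₂ : Set ℂ} (hC₁ : IsPreconnected C₁)
    (hC₂ : IsPreconnected C₂) (hd₁ : Disjoint C₁ K₁) (hd₂ : Disjoint C₂ K₂) {x y : ℂ}
    (hx₁ : x ∈ C₁) (hx₂ : x ∈ C₂) (hy₁ : y ∈ C₁) (hy₂ : y ∈ C₂) :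
    ∃ C : Set ℂ, IsPreconnected C ∧ Disjoint C (K₁ ∪ K₂) ∧ x ∈ C ∧ y ∈ C := by
  have hx : x ∉ K₁ ∪ K₂ := fun h =>
    h.elim (Set.disjoint_left.1 hd₁ hx₁) (Set.disjoint_left.1 hd₂ hx₂)
  have hy : y ∉ K₁ ∪ K₂ := fun h =>
    h.elim (Set.disjoint_left.1 hd₁ hy₁) (Set.disjoint_left.1 hd₂ hy₂)
  obtain ⟨L₁, hL₁, he₁⟩ := exists_log_of_isPreconnected hK₁.isClosed hC₁ hd₁ hx₁ hy₁
  obtain ⟨L₂, hL₂, he₂⟩ := exists_log_of_isPreconnected hK₂.isClosed hC₂ hd₂ hx₂ hy₂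
  obtain ⟨c, hc1, hc⟩ : ∃ c : ℂ, Complex.exp c = 1 ∧ ∀ z ∈ K₁ ∩ K₂, L₁ z = L₂ z + c := by
    rcases (K₁ ∩ K₂).eq_empty_or_nonempty with h0 | ⟨p, hp⟩
    · exact ⟨0, Complex.exp_zero, fun z hz => by simp [h0] at hz⟩
    have hexp : ∀ z ∈ K₁ ∩ K₂, Complex.exp (L₁ z) = Complex.exp (L₂ z) := fun z hz =>
      (he₁ z hz.1).trans (he₂ z hz.2).symm
    refine ⟨L₁ p - L₂ p, ?_, fun z hz => ?_⟩
    · rw [Complex.exp_sub, hexp p hp, div_self (Complex.exp_ne_zero _)]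
    · rw [← sub_eq_sub_of_exp_eq hK (hL₁.mono Set.inter_subset_left)
        (hL₂.mono Set.inter_subset_right) hexp hz hp]
      ring
  classical
  set L : ℂ → ℂ := fun z => if z ∈ K₁ then L₁ z else L₂ z + c with hLdef
  have hL1 : ∀ z ∈ K₁, L z = L₁ z := fun z hz => by simp [hLdef, hz]
  have hL2 : ∀ z ∈ K₂, L z = L₂ z + c := fun z hz => by
    by_cases h : z ∈ K₁
    · rw [hL1 z h, hc z ⟨h, hz⟩]
    · simp [hLdef, h]
  have hy' := mem_connectedComponentIn_compl_of_log (hK₁.union hK₂) hx hy L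
    ((hL₁.congr hL1).union_of_isClosed ((hL₂.add continuousOn_const).congr hL2)
      hK₁.isClosed hK₂.isClosed) (by
    rintro z (hz | hz)
    · rw [hL1 z hz, he₁ z hz]
    · rw [hL2 z hz, Complex.exp_add, he₂ z hz, hc1, mul_one])
  exact ⟨_, isPreconnected_connectedComponentIn,
    Set.disjoint_left.2 fun z hz => connectedComponentIn_subset _ _ hz,
    mem_connectedComponentIn hx, hy'⟩

/-! ### Splitting a compactum along one of its components -/

section Splitting

variable {X : Type*} [MetricSpace X] [CompactSpace X]

/-- In a compact Hausdorff space, components have arbitrarily small clopen neighbourhoods. -/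
theorem exists_isClopen_subset_of_connectedComponent_subset {X : Type*} [TopologicalSpace X]
    [T2Space X] [CompactSpace X] {x : X} {U : Set X} (hU : IsOpen U)
    (h : connectedComponent x ⊆ U) : ∃ N : Set X, IsClopen N ∧ x ∈ N ∧ N ⊆ U := by
  rw [connectedComponent_eq_iInter_isClopen] at h
  have : Nonempty {s : Set X // IsClopen s ∧ x ∈ s} := ⟨⟨Set.univ, isClopen_univ, trivial⟩⟩
  obtain ⟨⟨N, hN, hxN⟩, hNU⟩ := exists_subset_nhds_of_compactSpace
    (V := fun s : {s : Set X // IsClopen s ∧ x ∈ s} => (s : Set X))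
    (fun a b => ⟨⟨a ∩ b, a.2.1.inter b.2.1, a.2.2, b.2.2⟩, Set.inter_subset_left,
      Set.inter_subset_right⟩) (fun s => s.2.1.1) (fun y hy => hU.mem_nhds (h hy))
  exact ⟨N, hN, hxN, hNU⟩

/-- If the components form a null family, the components close to a given one are small. -/
theorem exists_forall_diam_connectedComponent_le
    (hnull : ∀ C : ℝ, 0 < C →
      {S : Set X | (∃ x, S = connectedComponent x) ∧ C < Metric.diam S}.Finite)
    (x₀ : X) {C : ℝ} (hC : 0 < C) :
    ∃ δ > 0, ∀ y, y ∉ connectedComponent x₀ → Metric.infDist y (connectedComponent x₀) < δ →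
      Metric.diam (connectedComponent y) ≤ C := by
  set Q := connectedComponent x₀ with hQ
  have hQne : Q.Nonempty := ⟨x₀, mem_connectedComponent⟩
  set T : Set (Set X) := {S | ((∃ x, S = connectedComponent x) ∧ C < Metric.diam S) ∧ S ≠ Q}
  have hT : T.Finite := (hnull C hC).subset fun S hS => hS.1
  have hclosed : IsClosed (⋃ S ∈ T, S) := hT.isClosed_biUnion fun S hS => by
    obtain ⟨⟨⟨x, rfl⟩, -⟩, -⟩ := hS
    exact isClosed_connectedComponent
  have hdisj : Disjoint Q (⋃ S ∈ T, S) := by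
    rw [Set.disjoint_iUnion₂_right]
    rintro S ⟨⟨⟨x, rfl⟩, -⟩, hne⟩
    exact connectedComponent_disjoint (Ne.symm hne)
  obtain ⟨δ, hδ, hth⟩ := hdisj.exists_thickenings isClosed_connectedComponent.isCompact hclosed
  refine ⟨δ, hδ, fun y hy hyd => ?_⟩
  by_contra! hcon
  have hyT : connectedComponent y ∈ T :=
    ⟨⟨⟨y, rfl⟩, hcon⟩, fun h => hy (h ▸ mem_connectedComponent)⟩
  refine Set.disjoint_left.1 hth (Metric.mem_thickening_iff_infDist_lt hQne |>.2 hyd)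
    (Metric.self_subset_thickening hδ _ (Set.mem_biUnion hyT mem_connectedComponent))

/-- Points outside a component `Q` have clopen neighbourhoods missing `Q` whose size tends to
zero on approach to `Q`. -/
theorem exists_isClopen_small_near_connectedComponent
    (hnull : ∀ C : ℝ, 0 < C →
      {S : Set X | (∃ x, S = connectedComponent x) ∧ C < Metric.diam S}.Finite) (x₀ : X) :
    ∃ N : X → Set X, (∀ x, IsClopen (N x)) ∧
      (∀ x, x ∉ connectedComponent x₀ → x ∈ N x) ∧
      (∀ x, Disjoint (N x) (connectedComponent x₀)) ∧
      ∀ ε > 0, ∃ δ > 0, ∀ x, ∀ y ∈ N x, Metric.infDist y (connectedComponent x₀) < δ →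
        dist x y < ε := by
  classical
  set Q := connectedComponent x₀ with hQ
  have hQne : Q.Nonempty := ⟨x₀, mem_connectedComponent⟩
  have hQc : IsClosed Q := isClosed_connectedComponent
  have hex : ∀ x, x ∉ Q → ∃ N : Set X, IsClopen N ∧ x ∈ N ∧
      N ⊆ {y | 2 * Metric.infDist y (connectedComponent x) < Metric.infDist y Q} := by
    intro x hx
    refine exists_isClopen_subset_of_connectedComponent_subset ?_ fun y hy => ?_
    · exact isOpen_lt (continuous_const.mul (Metric.continuous_infDist_pt _))
        (Metric.continuous_infDist_pt _)
    · have hyQ : y ∉ Q := fun h => hx (by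
        rw [hQ, connectedComponent_eq h, ← connectedComponent_eq hy]; exact mem_connectedComponent)
      rw [Set.mem_ofPred_eq, Metric.infDist_zero_of_mem hy, mul_zero]
      exact (hQc.notMem_iff_infDist_pos hQne).1 hyQ
  choose! N hN1 hN2 hN3 using hex
  have hNQ : ∀ x, x ∉ Q → ∀ y ∈ N x, y ∉ Q := fun x hx y hy hyQ => by
    have h1 : 2 * Metric.infDist y (connectedComponent x) < Metric.infDist y Q := hN3 x hx hy
    rw [Metric.infDist_zero_of_mem hyQ] at h1
    have h2 := Metric.infDist_nonneg (x := y) (s := connectedComponent x)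
    linarith
  refine ⟨fun x => if x ∈ Q then ∅ else N x, fun x => ?_, fun x hx => ?_, fun x => ?_, ?_⟩
  · by_cases hx : x ∈ Q
    · simpa [hx] using isClopen_empty
    · simpa [hx] using hN1 x hx
  · simpa [hx] using hN2 x hx
  · by_cases hx : x ∈ Q
    · simp [hx]
    · simpa [hx] using Set.disjoint_left.2 (hNQ x hx)
  · intro ε hε
    obtain ⟨δ, hδ, hdiam⟩ := exists_forall_diam_connectedComponent_le hnull x₀ (half_pos hε)
    refine ⟨min (δ / 2) (ε / 2), by positivity, fun x y hy hyQ => ?_⟩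
    by_cases hx : x ∈ Q
    · simp [hx] at hy
    simp only [hx, if_false] at hy
    have h1 : 2 * Metric.infDist y (connectedComponent x) < Metric.infDist y Q := hN3 x hx hy
    have h1' : Metric.infDist y (connectedComponent x) < min (δ / 2) (ε / 2) / 2 := by linarith
    obtain ⟨z, hz, hyz⟩ := (Metric.infDist_lt_iff ⟨x, mem_connectedComponent⟩).1 h1'
    have hxz : connectedComponent x = connectedComponent z := connectedComponent_eq hz
    have hzQ : z ∉ Q := fun h => hx (by
      rw [hQ, connectedComponent_eq h, ← hxz]; exact mem_connectedComponent)
    have h2 : Metric.infDist z Q < δ := by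
      have := Metric.infDist_le_infDist_add_dist (s := Q) (x := z) (y := y)
      rw [dist_comm] at this
      have := min_le_left (δ / 2) (ε / 2)
      linarith
    have h3 := hdiam z hzQ h2
    have h4 : dist x z ≤ Metric.diam (connectedComponent z) :=
      Metric.dist_le_diam_of_mem isClosed_connectedComponent.isCompact.isBounded
        (hxz ▸ mem_connectedComponent) mem_connectedComponent
    have := min_le_right (δ / 2) (ε / 2)
    have h5 := dist_triangle x z y
    rw [dist_comm z y] at h5
    linarith

theorem isClosed_union_of_color {X : Type*} [MetricSpace X] {Q R R' : Set X} (hR : IsClosed R)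
    (hQR : Q ⊆ R ∪ R') {N : X → Set X}
    (hsmall : ∀ ε > 0, ∃ δ > 0, ∀ x, ∀ y ∈ N x, Metric.infDist y Q < δ → dist x y < ε)
    {col : X → Prop} (hcol : ∀ x, col x → Metric.infEDist x R ≤ Metric.infEDist x R')
    {E : Set X} (hE : ∀ y ∈ E, y ∉ Q → ∃ x, y ∈ N x ∧ col x)
    (hloc : ∀ y ∉ Q, y ∉ E → ∀ᶠ z in 𝓝 y, z ∉ E) (hEQ : E ∩ Q = R) : IsClosed E := by
  rw [← isOpen_compl_iff, isOpen_iff_mem_nhds]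
  intro y hy
  by_cases hyQ : y ∈ Q
  swap
  · exact hloc y hyQ hy
  have hyR : y ∉ R := fun h => hy (hEQ ▸ h : y ∈ E ∩ Q).1
  have hyR' : y ∈ R' := (hQR hyQ).resolve_left hyR
  have hpos : 0 < Metric.infEDist y R := by
    rw [pos_iff_ne_zero]
    exact fun h => hyR (hR.closure_eq ▸ Metric.mem_closure_iff_infEDist_zero.2 h)
  obtain ⟨e, he0, he⟩ : ∃ e : ℝ, 0 < e ∧ ENNReal.ofReal (4 * e) < Metric.infEDist y R := by
    obtain ⟨c, hc0, hc⟩ := ENNReal.lt_iff_exists_nnreal_btwn.1 hpos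
    refine ⟨c / 4, ?_, ?_⟩
    · have : 0 < c := by exact_mod_cast hc0
      positivity
    · rwa [mul_div_cancel₀ _ (by norm_num : (4 : ℝ) ≠ 0), ENNReal.ofReal_coe_nnreal]
  obtain ⟨δ, hδ, hs⟩ := hsmall e he0
  filter_upwards [Metric.ball_mem_nhds y (lt_min hδ he0),
    hR.isOpen_compl.mem_nhds hyR] with z hz hzR hzE
  have hzy : dist z y < min δ e := hz
  by_cases hzQ : z ∈ Q
  · exact hzR (hEQ ▸ ⟨hzE, hzQ⟩)
  obtain ⟨x, hzx, hx⟩ := hE z hzE hzQ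
  have h1 : dist x z < e :=
    hs x z hzx ((Metric.infDist_le_dist_of_mem hyQ).trans_lt (hzy.trans_le (min_le_left _ _)))
  have h2 : dist x y < 2 * e := by
    have := dist_triangle x z y
    have := min_le_right δ e
    linarith
  have h3 : edist x y ≤ ENNReal.ofReal (2 * e) := by
    rw [edist_dist]
    exact ENNReal.ofReal_le_ofReal h2.le
  have h4 : Metric.infEDist y R ≤ ENNReal.ofReal (4 * e) := calc
    Metric.infEDist y R ≤ Metric.infEDist x R + edist y x := Metric.infEDist_le_infEDist_add_edist
    _ ≤ Metric.infEDist x R' + edist y x := add_le_add_left (hcol x hx) _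
    _ ≤ edist x y + edist x y := by
      rw [edist_comm y x]
      gcongr
      exact Metric.infEDist_le_edist_of_mem hyR'
    _ ≤ ENNReal.ofReal (2 * e) + ENNReal.ofReal (2 * e) := by gcongr
    _ = ENNReal.ofReal (4 * e) := by
      rw [← ENNReal.ofReal_add (by positivity) (by positivity)]
      ring_nf
  exact absurd he (not_lt.2 h4)

/-- A covering of a component `Q` of a compactum with a null family of components by two closed
sets extends to a covering of the whole space by two closed sets with the same intersection. -/
theorem exists_isClosed_cover_of_connectedComponent
    (hnull : ∀ C : ℝ, 0 < C →
      {S : Set X | (∃ x, S = connectedComponent x) ∧ C < Metric.diam S}.Finite) (x₀ : X)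
    {Q₁ Q₂ : Set X} (hQ₁ : IsClosed Q₁) (hQ₂ : IsClosed Q₂)
    (hQ : Q₁ ∪ Q₂ = connectedComponent x₀) :
    ∃ E₁ E₂ : Set X, IsClosed E₁ ∧ IsClosed E₂ ∧ E₁ ∪ E₂ = Set.univ ∧ E₁ ∩ E₂ = Q₁ ∩ Q₂ ∧
      Q₁ ⊆ E₁ ∧ Q₂ ⊆ E₂ ∧ E₂ ∩ connectedComponent x₀ ⊆ Q₂ := by
  classical
  obtain ⟨N, hNc, hN1, hN2, hN3⟩ := exists_isClopen_small_near_connectedComponent hnull x₀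
  rw [← hQ] at hN1 hN2 hN3 ⊢
  obtain ⟨t, htc, ht⟩ := TopologicalSpace.isOpen_iUnion_countable N fun x => (hNc x).isOpen
  obtain ⟨s, hs⟩ := (htc.insert x₀).exists_eq_range (Set.insert_nonempty _ _)
  have hcov : ∀ y ∉ Q₁ ∪ Q₂, ∃ n, y ∈ N (s n) := by
    intro y hy
    have h1 : y ∈ ⋃ x, N x := Set.mem_iUnion.2 ⟨y, hN1 y hy⟩
    rw [← ht] at h1
    obtain ⟨x, hxt, hyx⟩ := Set.mem_iUnion₂.1 h1
    have hxr : x ∈ Set.range s := hs ▸ Set.mem_insert_of_mem _ hxt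
    obtain ⟨n, rfl⟩ := hxr
    exact ⟨n, hyx⟩
  set idx : X → ℕ := fun y => if h : ∃ n, y ∈ N (s n) then Nat.find h else 0 with hidx
  have hidx1 : ∀ y ∉ Q₁ ∪ Q₂, y ∈ N (s (idx y)) := by
    intro y hy
    simp only [hidx, hcov y hy, dif_pos]
    exact Nat.find_spec (hcov y hy)
  have hidx2 : ∀ y ∉ Q₁ ∪ Q₂, ∀ᶠ z in 𝓝 y, z ∉ Q₁ ∪ Q₂ ∧ idx z = idx y := by
    intro y hy
    have h1 : ∀ᶠ z in 𝓝 y, z ∈ N (s (idx y)) := (hNc _).isOpen.mem_nhds (hidx1 y hy)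
    have h2 : ∀ᶠ z in 𝓝 y, ∀ n ∈ Finset.range (idx y), z ∉ N (s n) := by
      rw [Filter.eventually_all_finset]
      intro n hn
      refine (hNc _).isClosed.isOpen_compl.mem_nhds fun hyn => ?_
      have h3 : idx y ≤ n := by
        simp only [hidx, hcov y hy, dif_pos]
        exact Nat.find_min' _ hyn
      exact absurd (Finset.mem_range.1 hn) (not_lt.2 h3)
    filter_upwards [h1, h2] with z hz1 hz2
    refine ⟨Set.disjoint_left.1 (hN2 _) hz1, ?_⟩
    have hz : ∃ n, z ∈ N (s n) := ⟨_, hz1⟩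
    have : idx z = Nat.find hz := by simp only [hidx, hz, dif_pos]
    rw [this, Nat.find_eq_iff]
    exact ⟨hz1, fun n hn => hz2 n (Finset.mem_range.2 hn)⟩
  set col : X → Prop := fun x => Metric.infEDist x Q₁ ≤ Metric.infEDist x Q₂
  set E₁ : Set X := Q₁ ∪ {y | y ∉ Q₁ ∪ Q₂ ∧ col (s (idx y))} with hE₁
  set E₂ : Set X := Q₂ ∪ {y | y ∉ Q₁ ∪ Q₂ ∧ ¬ col (s (idx y))} with hE₂
  have hi₁ : E₁ ∩ (Q₁ ∪ Q₂) = Q₁ := by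
    ext y; simp only [hE₁, Set.mem_inter_iff, Set.mem_union, Set.mem_ofPred_eq]; tauto
  have hi₂ : E₂ ∩ (Q₁ ∪ Q₂) = Q₂ := by
    ext y; simp only [hE₂, Set.mem_inter_iff, Set.mem_union, Set.mem_ofPred_eq]; tauto
  refine ⟨E₁, E₂, ?_, ?_, ?_, ?_, Set.subset_union_left, Set.subset_union_left, hi₂.subset⟩
  · refine isClosed_union_of_color (R' := Q₂) hQ₁ subset_rfl hN3 (col := col) (fun x hx => hx) ?_ ?_
      hi₁
    · intro y hy hyQ
      rcases hy with hy | hy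
      · exact absurd (Or.inl hy) hyQ
      · exact ⟨_, hidx1 y hyQ, hy.2⟩
    · intro y hyQ hyE
      filter_upwards [hidx2 y hyQ] with z hz hzE
      rcases hzE with h | h
      · exact hz.1 (Or.inl h)
      · exact hyE (Or.inr ⟨hyQ, hz.2 ▸ h.2⟩)
  · refine isClosed_union_of_color (R' := Q₁) hQ₂
      (Set.union_comm Q₁ Q₂).subset hN3 (col := fun x => ¬ col x) (fun x hx => (not_le.1 hx).le) ?_ ?_
      hi₂
    · intro y hy hyQ
      rcases hy with hy | hy
      · exact absurd (Or.inr hy) hyQ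
      · exact ⟨_, hidx1 y hyQ, hy.2⟩
    · intro y hyQ hyE
      filter_upwards [hidx2 y hyQ] with z hz hzE
      rcases hzE with h | h
      · exact hz.1 (Or.inr h)
      · exact hyE (Or.inr ⟨hyQ, hz.2 ▸ h.2⟩)
  · ext y; simp only [hE₁, hE₂, Set.mem_union, Set.mem_ofPred_eq, Set.mem_univ]; tauto
  · ext y; simp only [hE₁, hE₂, Set.mem_inter_iff, Set.mem_union, Set.mem_ofPred_eq]; tauto

end Splitting

/-! ### Splittings of planar Peano compacta -/

theorem exists_isClosed_disjoint_cover {K : Set ℂ} (hK : IsCompact K) {x y : ℂ} (hx : x ∈ K)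
    (hy : y ∈ K) (hxy : y ∉ connectedComponentIn K x) :
    ∃ F₁ F₂ : Set ℂ, IsClosed F₁ ∧ IsClosed F₂ ∧ F₁ ∪ F₂ = K ∧ F₁ ∩ F₂ = ∅ ∧ x ∈ F₁ ∧ y ∈ F₂ := by
  have : CompactSpace K := isCompact_iff_compactSpace.1 hK
  rw [connectedComponentIn_eq_image hx] at hxy
  obtain ⟨N, hN, hxN, hNy⟩ := exists_isClopen_subset_of_connectedComponent_subset
    (x := (⟨x, hx⟩ : K)) (U := {⟨y, hy⟩}ᶜ) isClosed_singleton.isOpen_compl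
    (fun z hz hzy => hxy ⟨z, hz, congrArg Subtype.val hzy⟩)
  refine ⟨Subtype.val '' N, Subtype.val '' Nᶜ, hK.isClosed.isClosedMap_subtype_val _ hN.isClosed,
    hK.isClosed.isClosedMap_subtype_val _ hN.compl.isClosed, ?_, ?_, ⟨_, hxN, rfl⟩,
    ⟨⟨y, hy⟩, fun h => hNy h rfl, rfl⟩⟩
  · rw [← Set.image_union, Set.union_compl_self, Set.image_univ, Subtype.range_val]
  · rw [← Set.image_inter Subtype.val_injective, Set.inter_compl_self, Set.image_empty]

theorem IsPeanoCompactum.exists_isClosed_cover {K : Set ℂ} (hK : IsPeanoCompactum K) {x₀ : ℂ}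
    (hx₀ : x₀ ∈ K) {Q₁ Q₂ F : Set ℂ} (hQ₁ : IsClosed Q₁) (hQ₂ : IsClosed Q₂)
    (hQ : Q₁ ∪ Q₂ = connectedComponentIn K x₀) (hF : IsClosed F) (hFQ : Disjoint F Q₂) :
    ∃ E₁ E₂ : Set ℂ, IsClosed E₁ ∧ IsClosed E₂ ∧ E₁ ∪ E₂ = K ∧ E₁ ∩ E₂ = Q₁ ∩ Q₂ ∧
      Q₁ ⊆ E₁ ∧ Q₂ ⊆ E₂ ∧ Disjoint F E₂ := by
  obtain ⟨hKc, -, hnull⟩ := hK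
  have : CompactSpace K := isCompact_iff_compactSpace.1 hKc
  have hnull' : ∀ C : ℝ, 0 < C →
      {S : Set K | (∃ x, S = connectedComponent x) ∧ C < Metric.diam S}.Finite := by
    intro C hC
    refine ((hnull C hC).preimage
      (Subtype.val_injective.image_injective (α := K) (β := ℂ)).injOn).subset ?_
    rintro _ ⟨⟨x, rfl⟩, hd⟩
    refine ⟨⟨x, x.2, (connectedComponentIn_eq_image x.2).symm⟩, ?_⟩
    rwa [isometry_subtype_coe.diam_image]
  have hQK : Q₁ ∪ Q₂ ⊆ K := hQ ▸ connectedComponentIn_subset K x₀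
  set i : K → ℂ := Subtype.val with hi
  have hinj : Function.Injective i := Subtype.val_injective
  have hcl : IsClosedMap i := hKc.isClosed.isClosedMap_subtype_val
  have hQ' : i ⁻¹' Q₁ ∪ i ⁻¹' Q₂ = connectedComponent (⟨x₀, hx₀⟩ : K) := by
    rw [← Set.preimage_union, hQ, connectedComponentIn_eq_image hx₀, Set.preimage_image_eq _ hinj]
  have him : ∀ S ⊆ K, i '' (i ⁻¹' S) = S := fun S hS => by
    rw [Set.image_preimage_eq_inter_range, Subtype.range_val, Set.inter_eq_left.2 hS]
  have him1 := him Q₁ (Set.subset_union_left.trans hQK)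
  have him2 := him Q₂ (Set.subset_union_right.trans hQK)
  obtain ⟨E₁, E₂, hE₁, hE₂, hU, hI, h1, h2, h3⟩ := exists_isClosed_cover_of_connectedComponent
    hnull' _ (hQ₁.preimage continuous_subtype_val) (hQ₂.preimage continuous_subtype_val) hQ'
  have hsub : connectedComponent (⟨x₀, hx₀⟩ : K) ⊆ (E₂ ∩ i ⁻¹' F)ᶜ := fun y hy hyE =>
    Set.disjoint_left.1 hFQ hyE.2 (h3 ⟨hyE.1, hy⟩)
  obtain ⟨N, hN, hxN, hNE⟩ := exists_isClopen_subset_of_connectedComponent_subset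
    (hE₂.inter (hF.preimage continuous_subtype_val)).isOpen_compl hsub
  have hQN : i ⁻¹' Q₁ ∪ i ⁻¹' Q₂ ⊆ N := hQ' ▸ hN.connectedComponent_subset hxN
  refine ⟨i '' (E₁ ∪ Nᶜ), i '' (E₂ ∩ N), hcl _ (hE₁.union hN.compl.isClosed),
    hcl _ (hE₂.inter hN.isClosed), ?_, ?_, ?_, ?_, ?_⟩
  · have : E₁ ∪ Nᶜ ∪ E₂ ∩ N = Set.univ := by
      rw [Set.eq_univ_iff_forall] at hU ⊢
      intro y
      have := hU y
      simp only [Set.mem_union, Set.mem_inter_iff, Set.mem_compl_iff] at this ⊢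
      tauto
    rw [← Set.image_union, this, Set.image_univ, Subtype.range_val]
  · have : (E₁ ∪ Nᶜ) ∩ (E₂ ∩ N) = i ⁻¹' Q₁ ∩ i ⁻¹' Q₂ := by
      ext y
      have e1 : y ∈ E₁ ∩ E₂ ↔ y ∈ i ⁻¹' Q₁ ∩ i ⁻¹' Q₂ := by rw [hI]
      have e2 := @hQN y
      simp only [Set.mem_union, Set.mem_inter_iff, Set.mem_compl_iff] at e1 e2 ⊢
      tauto
    rw [← Set.image_inter hinj, this, Set.image_inter hinj, him1, him2]
  · rw [← him1]
    exact Set.image_mono (h1.trans Set.subset_union_left)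
  · rw [← him2]
    exact Set.image_mono (Set.subset_inter h2 (Set.subset_union_right.trans hQN))
  · rw [Set.disjoint_left]
    rintro _ hz ⟨y, ⟨hy2, hyN⟩, rfl⟩
    exact hNE hyN ⟨hy2, hz⟩

/-! ### Jordan curves -/

theorem IsJordanCurve.exists_param {J : Set ℂ} (hJ : IsJordanCurve J) {p : ℂ} (hp : p ∈ J) :
    ∃ γ : ℝ → ℂ, Continuous γ ∧ γ 0 = p ∧ γ 1 = p ∧ Set.InjOn γ (Set.Ico 0 1) ∧
      γ '' Set.Icc 0 1 = J := by
  obtain ⟨h⟩ := hJ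
  set q : ℂ := (h ⟨p, hp⟩).1 with hq
  have hq1 : ‖q‖ = 1 := mem_sphere_zero_iff_norm.1 (h ⟨p, hp⟩).2
  have hq0 : q ≠ 0 := norm_ne_zero_iff.1 (by rw [hq1]; exact one_ne_zero)
  have hmem : ∀ θ : ℝ, Complex.exp (((2 * Real.pi * θ : ℝ) : ℂ) * Complex.I) * q ∈
      Metric.sphere (0 : ℂ) 1 := fun θ => by
    rw [mem_sphere_zero_iff_norm, norm_mul, hq1, Complex.norm_exp_ofReal_mul_I, one_mul]
  set γ : ℝ → ℂ := fun θ => h.symm ⟨_, hmem θ⟩ with hγ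
  have hγp : ∀ θ : ℝ, Complex.exp (((2 * Real.pi * θ : ℝ) : ℂ) * Complex.I) = 1 → γ θ = p := by
    intro θ hθ
    have : (⟨_, hmem θ⟩ : Metric.sphere (0 : ℂ) 1) = h ⟨p, hp⟩ := by
      apply Subtype.ext
      simp only [hθ, one_mul, hq]
    simp only [hγ, this, Homeomorph.symm_apply_apply]
  refine ⟨γ, ?_, hγp 0 (by simp), hγp 1 (by simp), ?_, ?_⟩
  · exact continuous_subtype_val.comp (h.symm.continuous.comp
      (Continuous.subtype_mk (by fun_prop) _))
  · intro s hs t ht hst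
    have h1 := congrArg Subtype.val (h.symm.injective (Subtype.ext hst))
    have h2 := mul_right_cancel₀ hq0 h1
    obtain ⟨n, hn⟩ := Complex.exp_eq_exp_iff_exists_int.1 h2
    have h3 : s = t + n := by
      have h4 : ((2 * Real.pi * s : ℝ) : ℂ) * Complex.I =
          ((2 * Real.pi * (t + n) : ℝ) : ℂ) * Complex.I := by
        rw [hn]; push_cast; ring
      have h5 := mul_right_cancel₀ Complex.I_ne_zero h4
      exact mul_left_cancel₀ (by positivity) (Complex.ofReal_injective h5)
    have h6 : (n : ℝ) < 1 := by linarith [hs.2, ht.1]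
    have h7 : (-1 : ℝ) < n := by linarith [hs.1, ht.2]
    have h8 : n < 1 := by exact_mod_cast h6
    have h9 : -1 < n := by exact_mod_cast h7
    have h10 : n = 0 := by omega
    rw [h3, h10]; simp
  · apply Set.Subset.antisymm
    · rintro _ ⟨t, -, rfl⟩
      exact (h.symm _).2
    · intro z hz
      have hz1 : ‖(h ⟨z, hz⟩ : ℂ)‖ = 1 := mem_sphere_zero_iff_norm.1 (h ⟨z, hz⟩).2
      set w : ℂ := h ⟨z, hz⟩ / q with hw
      have hw1 : ‖w‖ = 1 := by rw [hw, norm_div, hz1, hq1, div_one]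
      refine ⟨Int.fract (w.arg / (2 * Real.pi)),
        ⟨Int.fract_nonneg _, (Int.fract_lt_one _).le⟩, ?_⟩
      have h1 : Complex.exp (((2 * Real.pi * Int.fract (w.arg / (2 * Real.pi)) : ℝ) : ℂ) *
          Complex.I) = w := by
        have h2 : ((2 * Real.pi * Int.fract (w.arg / (2 * Real.pi)) : ℝ) : ℂ) * Complex.I =
            (w.arg : ℂ) * Complex.I +
              ((-⌊w.arg / (2 * Real.pi)⌋ : ℤ) : ℂ) * (2 * Real.pi * Complex.I) := by
          have h3 : 2 * Real.pi * Int.fract (w.arg / (2 * Real.pi)) =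
              w.arg - ⌊w.arg / (2 * Real.pi)⌋ * (2 * Real.pi) := by
            rw [Int.fract]
            field_simp
          rw [h3]; push_cast; ring
        rw [h2, Complex.exp_eq_exp_iff_exists_int.2 ⟨_, rfl⟩]
        have := Complex.norm_mul_exp_arg_mul_I w
        rwa [hw1, Complex.ofReal_one, one_mul] at this
      have h3 : (⟨_, hmem (Int.fract (w.arg / (2 * Real.pi)))⟩ : Metric.sphere (0 : ℂ) 1) =
          h ⟨z, hz⟩ := by
        apply Subtype.ext
        exact (congrArg (· * q) h1).trans (div_mul_cancel₀ _ hq0)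
      simp only [hγ, h3, Homeomorph.symm_apply_apply]

theorem IsJordanCurve.exists_small_split {J : Set ℂ} (hJ : IsJordanCurve J) {p : ℂ} (hp : p ∈ J)
    {r : ℝ} (hr : 0 < r) : ∃ Q₁ Q₂ : Set ℂ, IsClosed Q₁ ∧ IsClosed Q₂ ∧ Q₁ ∪ Q₂ = J ∧
      IsPreconnected Q₁ ∧ p ∉ Q₁ ∧ p ∈ Q₂ ∧ Q₂ ⊆ Metric.ball p r := by
  obtain ⟨γ, hc, h0, h1, hinj, him⟩ := hJ.exists_param hp
  obtain ⟨e₀, he₀, hb₀⟩ := Metric.continuous_iff.1 hc 0 r hr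
  obtain ⟨e₁, he₁, hb₁⟩ := Metric.continuous_iff.1 hc 1 r hr
  rw [h0] at hb₀
  rw [h1] at hb₁
  obtain ⟨η, hη0, hη⟩ : ∃ η : ℝ, 0 < η ∧ η < min (min e₀ e₁) (1 / 2) :=
    exists_between (by positivity)
  rw [lt_min_iff, lt_min_iff] at hη
  obtain ⟨⟨hη1, hη2⟩, hη3⟩ := hη
  refine ⟨γ '' Set.Icc η (1 - η), γ '' (Set.Icc 0 η ∪ Set.Icc (1 - η) 1),
    (isCompact_Icc.image hc).isClosed, ((isCompact_Icc.union isCompact_Icc).image hc).isClosed, ?_,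
    isPreconnected_Icc.image _ hc.continuousOn, ?_, ⟨0, Or.inl ⟨le_rfl, hη0.le⟩, h0⟩, ?_⟩
  · rw [← Set.image_union, ← him]
    congr 1
    ext t
    simp only [Set.mem_union, Set.mem_Icc]
    constructor
    · rintro (h | h | h) <;> constructor <;> linarith
    · rintro ⟨ha, hb⟩
      rcases le_total t η with h | h
      · exact Or.inr (Or.inl ⟨ha, h⟩)
      rcases le_total t (1 - η) with h' | h'
      · exact Or.inl ⟨h, h'⟩
      · exact Or.inr (Or.inr ⟨h', hb⟩)
  · rintro ⟨t, ht, htp⟩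
    have := hinj ⟨hη0.le.trans ht.1, by linarith [ht.2]⟩ ⟨le_rfl, one_pos⟩ (htp.trans h0.symm)
    linarith [ht.1]
  · rintro _ ⟨t, ht | ht, rfl⟩
    · exact hb₀ t (by rw [Real.dist_eq, abs_lt]; constructor <;> linarith [ht.1, ht.2])
    · exact hb₁ t (by rw [Real.dist_eq, abs_lt]; constructor <;> linarith [ht.1, ht.2])

theorem IsJordanCurve.exists_arcs {J : Set ℂ} (hJ : IsJordanCurve J) {z₁ z₂ : ℂ} (h₁ : z₁ ∈ J)
    (h₂ : z₂ ∈ J) (hne : z₁ ≠ z₂) :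
    ∃ Q₁ Q₂ : Set ℂ, IsArc Q₁ ∧ IsArc Q₂ ∧ Q₁ ∪ Q₂ = J ∧ Q₁ ∩ Q₂ = {z₁, z₂} := by
  obtain ⟨γ, hc, h0, h1, hinj, him⟩ := hJ.exists_param h₁
  rw [← him] at h₂
  obtain ⟨t, ht, rfl⟩ := h₂
  have ht0 : 0 < t := ht.1.lt_of_ne fun h => hne (by rw [← h, h0])
  have ht1 : t < 1 := ht.2.lt_of_ne fun h => hne (by rw [h, h1])
  have hz : ∀ s ∈ Set.Icc (0 : ℝ) 1, γ s = z₁ → s = 0 ∨ s = 1 := fun s hs h => by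
    rcases hs.2.lt_or_eq with h' | h'
    · exact Or.inl (hinj ⟨hs.1, h'⟩ ⟨le_rfl, one_pos⟩ (h.trans h0.symm))
    · exact Or.inr h'
  have hinj' : Set.InjOn γ (Set.Ioc 0 1) := fun a ha b hb hab => by
    rcases ha.2.lt_or_eq with ha' | ha'
    · rcases hb.2.lt_or_eq with hb' | hb'
      · exact hinj ⟨ha.1.le, ha'⟩ ⟨hb.1.le, hb'⟩ hab
      · rw [hb', h1] at hab
        rcases hz a ⟨ha.1.le, ha.2⟩ hab with h | h <;> linarith [ha.1]
    · rw [ha', h1] at hab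
      rcases hz b ⟨hb.1.le, hb.2⟩ hab.symm with h | h <;> linarith [hb.1]
  refine ⟨γ '' Set.Icc 0 t, γ '' Set.Icc t 1, ⟨fun s => γ (t * s), ?_, ?_, ?_⟩,
    ⟨fun s => γ ((1 - t) * s + t), ?_, ?_, ?_⟩, ?_, ?_⟩
  · exact (hc.comp (continuous_const.mul continuous_id)).continuousOn
  · intro a ha b hb hab
    have := hinj (x₁ := t * a) (x₂ := t * b) ⟨mul_nonneg ht0.le ha.1, by nlinarith [ha.2]⟩
      ⟨mul_nonneg ht0.le hb.1, by nlinarith [hb.2]⟩ hab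
    exact mul_left_cancel₀ ht0.ne' this
  · rw [show (fun s => γ (t * s)) = γ ∘ fun s => t * s from rfl, Set.image_comp,
      Set.image_mul_left_Icc ht0.le zero_le_one, mul_zero, mul_one]
  · exact (hc.comp ((continuous_const.mul continuous_id).add continuous_const)).continuousOn
  · intro a ha b hb hab
    have := hinj' (x₁ := (1 - t) * a + t) (x₂ := (1 - t) * b + t)
      ⟨by nlinarith [ha.1], by nlinarith [ha.2]⟩ ⟨by nlinarith [hb.1], by nlinarith [hb.2]⟩ hab
    exact mul_left_cancel₀ (sub_pos.2 ht1).ne' (add_right_cancel this)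
  · rw [show (fun s => γ ((1 - t) * s + t)) = γ ∘ fun s => (1 - t) * s + t from rfl,
      Set.image_comp, Set.image_affine_Icc' (sub_pos.2 ht1)]
    simp
  · rw [← Set.image_union, Set.Icc_union_Icc_eq_Icc ht.1 ht.2, him]
  · ext z
    constructor
    · rintro ⟨⟨a, ha, rfl⟩, ⟨b, hb, hab⟩⟩
      rcases hb.2.lt_or_eq with hb' | hb'
      · have := hinj ⟨ht.1.trans hb.1, hb'⟩ ⟨ha.1, ha.2.trans_lt ht1⟩ hab
        have hat : a = t := le_antisymm ha.2 (this ▸ hb.1)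
        exact Or.inr (by rw [hat]; rfl)
      · rw [hb', h1] at hab
        exact Or.inl hab.symm
    · rintro (rfl | rfl)
      · exact ⟨⟨0, ⟨le_rfl, ht.1⟩, h0⟩, ⟨1, ⟨ht.2, le_rfl⟩, h1⟩⟩
      · exact ⟨⟨t, ⟨ht.1, le_rfl⟩, rfl⟩, ⟨t, ⟨le_rfl, ht.2⟩, rfl⟩⟩

theorem IsJordanCurve.isPreconnected_diff_singleton {J : Set ℂ} (hJ : IsJordanCurve J) {p : ℂ}
    (hp : p ∈ J) : IsPreconnected (J \ {p}) := by
  obtain ⟨γ, hc, h0, h1, hinj, him⟩ := hJ.exists_param hp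
  have : J \ {p} = γ '' Set.Ioo 0 1 := by
    ext z
    constructor
    · rintro ⟨hz, hzp⟩
      rw [← him] at hz
      obtain ⟨t, ht, rfl⟩ := hz
      refine ⟨t, ⟨ht.1.lt_of_ne fun h => hzp ?_, ht.2.lt_of_ne fun h => hzp ?_⟩, rfl⟩
      · rw [← h]; exact h0
      · rw [h]; exact h1
    · rintro ⟨t, ht, rfl⟩
      refine ⟨him ▸ ⟨t, Set.Ioo_subset_Icc_self ht, rfl⟩, fun h => ?_⟩
      have := hinj ⟨ht.1.le, ht.2⟩ ⟨le_rfl, one_pos⟩ (Eq.trans h h0.symm)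
      exact ht.1.ne' this
  rw [this]
  exact isPreconnected_Ioo.image _ hc.continuousOn

theorem IsArc.isClosed {A : Set ℂ} (hA : IsArc A) : IsClosed A := by
  obtain ⟨f, hf, -, rfl⟩ := hA
  exact (isCompact_Icc.image_of_continuousOn hf).isClosed

theorem IsArc.exists_ne {A : Set ℂ} (hA : IsArc A) : ∃ a ∈ A, ∃ b ∈ A, a ≠ b := by
  obtain ⟨f, hf, hinj, rfl⟩ := hA
  exact ⟨f 0, ⟨0, by simp, rfl⟩, f 1, ⟨1, by simp, rfl⟩,
    fun h => zero_ne_one (hinj (by simp) (by simp) h)⟩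

theorem IsArc.hausdorffMeasure_pos {A : Set ℂ} (hA : IsArc A) : 0 < μH[1] A := by
  obtain ⟨a, ha, b, hb, hab⟩ := hA.exists_ne
  have hconn : IsPreconnected A := by
    obtain ⟨f, hf, hinj, rfl⟩ := hA
    exact isPreconnected_Icc.image _ hf
  have hlip : LipschitzWith 1 fun z => dist z a := LipschitzWith.dist_left a
  have hsub : Set.Icc 0 (dist b a) ⊆ (fun z => dist z a) '' A := by
    have := (hconn.image _ hlip.continuous.continuousOn).ordConnected.out
      (Set.mem_image_of_mem _ ha) (Set.mem_image_of_mem _ hb)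
    simpa using this
  have h1 := hlip.hausdorffMeasure_image_le (d := 1) zero_le_one A
  have h2 : (μH[1] : Measure ℝ) (Set.Icc 0 (dist b a)) = ENNReal.ofReal (dist b a) := by
    rw [MeasureTheory.hausdorffMeasure_real, Real.volume_Icc, sub_zero]
  have h3 : 0 < ENNReal.ofReal (dist b a) := ENNReal.ofReal_pos.2 (dist_pos.2 hab.symm)
  have h4 := measure_mono (μ := (μH[1] : Measure ℝ)) hsub
  rw [h2] at h4
  have h5 := h3.trans_le (h4.trans h1)
  simpa using h5

/-! ### Local connectivity at the boundary -/

theorem IsPreconnected.subset_of_disjoint_frontier {X : Type*} [TopologicalSpace X] {C U : Set X}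
    (hC : IsPreconnected C) (hd : Disjoint C (frontier U)) {x : X} (hx : x ∈ C) (hxU : x ∈ U) :
    C ⊆ U := by
  intro y hy
  by_contra hyU
  have hcov : C ⊆ interior U ∪ (closure U)ᶜ := fun z hz => by
    by_cases h : z ∈ closure U
    · by_contra hn
      exact Set.disjoint_left.1 hd hz ⟨h, fun hi => hn (Or.inl hi)⟩
    · exact Or.inr h
  obtain ⟨z, -, hz1, hz2⟩ := hC _ _ isOpen_interior isClosed_closure.isOpen_compl hcov
    ⟨x, hx, (hcov hx).resolve_right fun h => h (subset_closure hxU)⟩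
    ⟨y, hy, (hcov hy).resolve_left fun h => hyU (interior_subset h)⟩
  exact hz2 (subset_closure (interior_subset hz1))

theorem IsGeneralizedJordanDomain.exists_isPreconnected_near {Ω : Set ℂ}
    (hΩ : IsGeneralizedJordanDomain Ω) {ξ : ℂ} (hξ : ξ ∈ frontier Ω) {r : ℝ} (hr : 0 < r) :
    ∃ δ > 0, ∀ x ∈ Ω ∩ Metric.ball ξ δ, ∀ y ∈ Ω ∩ Metric.ball ξ δ,
      ∃ W, IsPreconnected W ∧ W ⊆ Ω ∩ Metric.ball ξ r ∧ x ∈ W ∧ y ∈ W := by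
  obtain ⟨⟨-, hopen, hconn⟩, -, hP, hJ⟩ := hΩ
  obtain ⟨Q₁, Q₂, hQ₁, hQ₂, hQ, hpre, hξ₁, hξ₂, hsub⟩ : ∃ Q₁ Q₂ : Set ℂ, IsClosed Q₁ ∧
      IsClosed Q₂ ∧ Q₁ ∪ Q₂ = connectedComponentIn (frontier Ω) ξ ∧ IsPreconnected Q₁ ∧ ξ ∉ Q₁ ∧
      ξ ∈ Q₂ ∧ Q₂ ⊆ Metric.ball ξ r := by
    rcases hJ ξ hξ with h | h
    · exact ⟨∅, {ξ}, isClosed_empty, isClosed_singleton, by rw [h, Set.empty_union],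
        isPreconnected_empty, Set.notMem_empty _, rfl,
        Set.singleton_subset_iff.2 (Metric.mem_ball_self hr)⟩
    · exact h.exists_small_split (mem_connectedComponentIn hξ) hr
  obtain ⟨E₁, E₂, hE₁, hE₂, hU, hI, h1, h2, hF⟩ := hP.exists_isClosed_cover hξ hQ₁ hQ₂ hQ
    (F := (Metric.ball ξ r)ᶜ) Metric.isOpen_ball.isClosed_compl
    (Set.disjoint_left.2 fun z hz hz2 => hz (hsub hz2))
  have hξE : ξ ∉ E₁ := fun h => hξ₁ (hI.subset ⟨h, h2 hξ₂⟩).1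
  obtain ⟨δ', hδ', hδ'E⟩ := Metric.isOpen_iff.1 hE₁.isOpen_compl ξ hξE
  have hSr : Disjoint (Metric.sphere ξ r) (Metric.ball ξ r) := Metric.sphere_disjoint_ball
  have hK : (E₂ ∪ Q₁) ∩ (Metric.sphere ξ r ∪ E₁) = Q₁ := by
    apply Set.Subset.antisymm
    · rintro z ⟨hz | hz, hz' | hz'⟩
      · exact absurd hz (Set.disjoint_left.1 hF (Set.disjoint_left.1 hSr hz'))
      · exact (hI.subset ⟨hz', hz⟩).1
      · exact hz
      · exact hz
    · exact fun z hz => ⟨Or.inr hz, Or.inr (h1 hz)⟩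
  have hE₁K : E₁ ⊆ frontier Ω := hU ▸ Set.subset_union_left
  have hE₂K : E₂ ⊆ frontier Ω := hU ▸ Set.subset_union_right
  have hdΩ : Disjoint Ω (frontier Ω) := Set.disjoint_left.2 fun z hz hzf =>
    (hopen.frontier_eq ▸ hzf).2 hz
  refine ⟨min δ' r, lt_min hδ' hr, fun x hx y hy => ?_⟩
  have hball : Disjoint (Metric.ball ξ (min δ' r)) (Metric.sphere ξ r ∪ E₁) := by
    rw [Set.disjoint_union_right]
    exact ⟨(hSr.mono_right (Metric.ball_subset_ball (min_le_right _ _))).symm,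
      Set.disjoint_left.2 fun z hz => hδ'E (Metric.ball_subset_ball (min_le_left _ _) hz)⟩
  obtain ⟨C, hC, hCd, hxC, hyC⟩ := exists_isPreconnected_of_union
    (K₁ := E₂ ∪ Q₁) (K₂ := Metric.sphere ξ r ∪ E₁)
    ((hP.1.of_isClosed_subset hE₂ hE₂K).union
      (hP.1.of_isClosed_subset hQ₁ (h1.trans hE₁K)))
    ((isCompact_sphere ξ r).union (hP.1.of_isClosed_subset hE₁ hE₁K)) (hK.symm ▸ hpre)
    hconn.isPreconnected Metric.isPreconnected_ball
    (hdΩ.mono_right (Set.union_subset hE₂K (h1.trans hE₁K))) hball hx.1 hx.2 hy.1 hy.2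
  have hC1 : Disjoint C (frontier Ω) := hCd.mono_right (by
    rw [← hU]
    rintro z (hz | hz)
    · exact Or.inr (Or.inr hz)
    · exact Or.inl (Or.inl hz))
  have hC2 : Disjoint C (frontier (Metric.ball ξ r)) := hCd.mono_right (by
    rw [frontier_ball ξ hr.ne']
    exact fun z hz => Or.inr (Or.inl hz))
  exact ⟨C, hC, Set.subset_inter (hC.subset_of_disjoint_frontier hC1 hxC hx.1)
    (hC.subset_of_disjoint_frontier hC2 hxC
      (Metric.ball_subset_ball (min_le_right _ _) hx.2)), hxC, hyC⟩

/-! ### Existence of the continuous extension -/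

theorem IsHomeoOnto.exists_inverse {φ : ℂ → ℂ} {D Ω : Set ℂ} (h : IsHomeoOnto φ D Ω) :
    ∃ ψ : ℂ → ℂ, ContinuousOn ψ Ω ∧ Set.MapsTo ψ Ω D ∧ (∀ z ∈ D, ψ (φ z) = z) ∧
      ∀ w ∈ Ω, φ (ψ w) = w := by
  obtain ⟨-, hb, ψ, hψ, hinv⟩ := h
  refine ⟨ψ, hψ, fun w hw => ?_, hinv.1, hinv.2⟩
  obtain ⟨z, hz, rfl⟩ := hb.surjOn hw
  rwa [hinv.1 hz]

theorem IsHomeoOnto.notMem_of_tendsto {φ : ℂ → ℂ} {D Ω : Set ℂ} (h : IsHomeoOnto φ D Ω)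
    (hΩ : IsOpen Ω) {F : Filter ℂ} [F.NeBot] {z w : ℂ} (hF : F ≤ 𝓝[D] z) (hz : z ∉ D)
    (hw : Tendsto φ F (𝓝 w)) : w ∉ Ω := by
  obtain ⟨ψ, hψ, hψm, hψφ, -⟩ := h.exists_inverse
  intro hwΩ
  have h1 : Tendsto (ψ ∘ φ) F (𝓝 (ψ w)) :=
    ((hψ.continuousAt (hΩ.mem_nhds hwΩ)).tendsto).comp hw
  have h2 : ψ ∘ φ =ᶠ[F] id := by
    filter_upwards [hF self_mem_nhdsWithin] with x hx using hψφ x hx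
  have h3 : Tendsto id F (𝓝 z) := (tendsto_id'.2 (hF.trans nhdsWithin_le_nhds))
  exact hz (tendsto_nhds_unique (h1.congr' h2) h3 ▸ hψm hwΩ)

theorem ExtendsContinuously.mem_frontier {φ φb : ℂ → ℂ} {D Ω : Set ℂ}
    (h : ExtendsContinuously φ φb D Ω) (hφ : IsHomeoOnto φ D Ω) (hD : IsOpen D) (hΩ : IsOpen Ω)
    {z : ℂ} (hz : z ∈ frontier D) : φb z ∈ frontier Ω := by
  obtain ⟨hc, he, hm⟩ := h
  rw [hD.frontier_eq] at hz
  rw [hΩ.frontier_eq]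
  have : (𝓝[D] z).NeBot := mem_closure_iff_nhdsWithin_neBot.1 hz.1
  refine ⟨hm hz.1, hφ.notMem_of_tendsto hΩ (F := 𝓝[D] z) le_rfl hz.2 ?_⟩
  have h1 : Tendsto φb (𝓝[D] z) (𝓝 (φb z)) :=
    (hc z hz.1).mono_left (nhdsWithin_mono _ subset_closure)
  refine h1.congr' ?_
  filter_upwards [self_mem_nhdsWithin] with x hx using he hx

theorem IsHomeoOnto.mem_frontier_of_mapClusterPt {φ : ℂ → ℂ} {D Ω : Set ℂ}
    (h : IsHomeoOnto φ D Ω) (hΩ : IsOpen Ω) {z w : ℂ} (hz : z ∉ D)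
    (hw : MapClusterPt w (𝓝[D] z) φ) : w ∈ frontier Ω := by
  rw [hΩ.frontier_eq]
  refine ⟨isClosed_closure.mem_of_mapClusterPt hw ?_, ?_⟩
  · filter_upwards [self_mem_nhdsWithin] with x hx using subset_closure (h.2.1.mapsTo hx)
  · obtain ⟨U, hU, hUw⟩ := mapClusterPt_iff_ultrafilter.1 hw
    exact h.notMem_of_tendsto hΩ hU hz hUw

theorem IsHomeoOnto.exists_image_mem_sphere {φ : ℂ → ℂ} {D Ω : Set ℂ} (h : IsHomeoOnto φ D Ω)
    {W : Set ℂ} (hW : IsPreconnected W) (hWΩ : W ⊆ Ω) {z₀ z d : ℂ} {r : ℝ} (hz : z ∈ D)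
    (hd : d ∈ D) (hzW : φ z ∈ W) (hdW : φ d ∈ W) (hzr : dist z z₀ ≤ r) (hdr : r ≤ dist d z₀) :
    ∃ u ∈ W, u ∈ φ '' (D ∩ Metric.sphere z₀ r) := by
  obtain ⟨ψ, hψ, hψm, hψφ, hφψ⟩ := h.exists_inverse
  have hc : ContinuousOn (fun u => dist (ψ u) z₀) W :=
    ((continuous_id.dist continuous_const).comp_continuousOn (hψ.mono hWΩ) :)
  obtain ⟨u, hu, hur⟩ := hW.intermediate_value hzW hdW hc
    (show r ∈ Set.Icc _ _ by
      simp only [hψφ z hz, hψφ d hd]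
      exact ⟨hzr, hdr⟩)
  exact ⟨u, hu, ψ u, ⟨hψm (hWΩ hu), hur⟩, hφψ u (hWΩ hu)⟩

theorem OscLiminfZero.frequently_lt {φ : ℂ → ℂ} {D Ω : Set ℂ} (hφ : Set.MapsTo φ D Ω)
    (hΩ : Bornology.IsBounded Ω) {z₀ : ℂ} (h : OscLiminfZero φ D z₀) {s : ℝ} (hs : 0 < s) :
    ∃ᶠ r in 𝓝[>] (0 : ℝ), oscDiam φ D z₀ r < s := by
  refine frequently_lt_of_liminf_lt ?_ (h.trans_lt hs)
  refine IsBoundedUnder.isCoboundedUnder_ge ⟨Metric.diam Ω, ?_⟩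
  rw [Filter.eventually_map]
  exact Filter.Eventually.of_forall fun r => Metric.diam_mono
    ((Set.image_mono Set.inter_subset_left).trans hφ.image_subset) hΩ

theorem IsHomeoOnto.mapClusterPt_unique {φ : ℂ → ℂ} {D Ω : Set ℂ} (h : IsHomeoOnto φ D Ω)
    (hΩ : IsGeneralizedJordanDomain Ω) {z₀ : ℂ} (hz₀ : z₀ ∉ D) (hosc : OscLiminfZero φ D z₀)
    {w₁ w₂ : ℂ} (h₁ : MapClusterPt w₁ (𝓝[D] z₀) φ) (h₂ : MapClusterPt w₂ (𝓝[D] z₀) φ) :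
    w₁ = w₂ := by
  by_contra hne
  have hs : 0 < dist w₁ w₂ / 3 := div_pos (dist_pos.2 hne) (by norm_num)
  set s := dist w₁ w₂ / 3 with hsdef
  obtain ⟨δ₁, hδ₁, H₁⟩ := hΩ.exists_isPreconnected_near
    (h.mem_frontier_of_mapClusterPt hΩ.1.2.1 hz₀ h₁) hs
  obtain ⟨δ₂, hδ₂, H₂⟩ := hΩ.exists_isPreconnected_near
    (h.mem_frontier_of_mapClusterPt hΩ.1.2.1 hz₀ h₂) hs
  have key : ∀ {w : ℂ} {δ : ℝ}, 0 < δ → MapClusterPt w (𝓝[D] z₀) φ → ∀ r > 0,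
      ∃ z ∈ D, dist z z₀ < r ∧ φ z ∈ Ω ∩ Metric.ball w δ := by
    intro w δ hδ hw r hr
    have h1 := mapClusterPt_iff_frequently.1 hw _ (Metric.ball_mem_nhds w hδ)
    obtain ⟨z, hz, hzD, hzr⟩ := (h1.and_eventually (Filter.Eventually.and self_mem_nhdsWithin
      (nhdsWithin_le_nhds (Metric.ball_mem_nhds z₀ hr)))).exists
    exact ⟨z, hzD, hzr, h.2.1.mapsTo hzD, hz⟩
  obtain ⟨d₁, hd₁, -, hd₁'⟩ := key hδ₁ h₁ 1 one_pos
  obtain ⟨d₂, hd₂, -, hd₂'⟩ := key hδ₂ h₂ 1 one_pos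
  have hm₁ : 0 < dist d₁ z₀ := dist_pos.2 fun h => hz₀ (h ▸ hd₁)
  have hm₂ : 0 < dist d₂ z₀ := dist_pos.2 fun h => hz₀ (h ▸ hd₂)
  obtain ⟨r, hr, hr0, hrm⟩ := ((hosc.frequently_lt h.2.1.mapsTo hΩ.2.1 hs).and_eventually
    (Filter.Eventually.and self_mem_nhdsWithin (nhdsWithin_le_nhds
      (gt_mem_nhds (lt_min hm₁ hm₂))))).exists
  obtain ⟨hr₁, hr₂⟩ := lt_min_iff.1 hrm
  obtain ⟨z₁, hz₁, hzr₁, hz₁'⟩ := key hδ₁ h₁ r hr0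
  obtain ⟨z₂, hz₂, hzr₂, hz₂'⟩ := key hδ₂ h₂ r hr0
  obtain ⟨W₁, hW₁, hWs₁, hzW₁, hdW₁⟩ := H₁ _ hz₁' _ hd₁'
  obtain ⟨W₂, hW₂, hWs₂, hzW₂, hdW₂⟩ := H₂ _ hz₂' _ hd₂'
  obtain ⟨u₁, hu₁, hu₁'⟩ := h.exists_image_mem_sphere hW₁ (hWs₁.trans Set.inter_subset_left)
    hz₁ hd₁ hzW₁ hdW₁ hzr₁.le hr₁.le
  obtain ⟨u₂, hu₂, hu₂'⟩ := h.exists_image_mem_sphere hW₂ (hWs₂.trans Set.inter_subset_left)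
    hz₂ hd₂ hzW₂ hdW₂ hzr₂.le hr₂.le
  have hb : Bornology.IsBounded (φ '' (D ∩ Metric.sphere z₀ r)) := hΩ.2.1.subset
    ((Set.image_mono Set.inter_subset_left).trans h.2.1.mapsTo.image_subset)
  have h3 : dist u₁ u₂ < s := (Metric.dist_le_diam_of_mem hb hu₁' hu₂').trans_lt hr
  have h4 : dist u₁ w₁ < s := (hWs₁ hu₁).2
  have h5 : dist u₂ w₂ < s := (hWs₂ hu₂).2
  have h6 := dist_triangle4 w₁ u₁ u₂ w₂
  rw [dist_comm w₁ u₁] at h6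
  have h7 : dist w₁ w₂ = 3 * s := by rw [hsdef]; ring
  linarith

theorem IsHomeoOnto.exists_extendsContinuously {φ : ℂ → ℂ} {D Ω : Set ℂ}
    (h : IsHomeoOnto φ D Ω) (hD : IsOpen D) (hΩ : IsGeneralizedJordanDomain Ω)
    (hosc : ∀ z₀ ∈ frontier D, OscLiminfZero φ D z₀) :
    ∃ φb : ℂ → ℂ, ExtendsContinuously φ φb D Ω := by
  have hmaps : ∀ z, ∀ᶠ x in 𝓝[D] z, φ x ∈ closure Ω := fun z => by
    filter_upwards [self_mem_nhdsWithin] with x hx using subset_closure (h.2.1.mapsTo hx)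
  have hlim : ∀ z ∈ closure D, ∃ w, Tendsto φ (𝓝[D] z) (𝓝 w) := by
    intro z hz
    by_cases hzD : z ∈ D
    · exact ⟨φ z, h.1 z hzD⟩
    have : (𝓝[D] z).NeBot := mem_closure_iff_nhdsWithin_neBot.1 hz
    have hcpt : IsCompact (closure Ω) := hΩ.2.1.isCompact_closure
    obtain ⟨w, -, hw⟩ := hcpt.exists_mapClusterPt (f := 𝓝[D] z) (u := φ)
      (tendsto_principal.2 (hmaps z))
    exact ⟨w, hcpt.tendsto_nhds_of_unique_mapClusterPt (hmaps z) fun x _ hx =>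
      h.mapClusterPt_unique hΩ hzD (hosc z (hD.frontier_eq ▸ ⟨hz, hzD⟩)) hx hw⟩
  refine ⟨extendFrom D φ, continuousOn_extendFrom subset_rfl hlim, fun z hz => ?_, fun z hz => ?_⟩
  · exact extendFrom_eq (subset_closure hz) (h.1 z hz)
  · obtain ⟨w, hw⟩ := hlim z hz
    have : (𝓝[D] z).NeBot := mem_closure_iff_nhdsWithin_neBot.1 hz
    rw [extendFrom_eq hz hw]
    exact isClosed_closure.mem_of_tendsto hw (hmaps z)

/-! ### Injectivity of the extension -/

theorem ExtendsContinuously.exists_near {φ φb : ℂ → ℂ} {D Ω : Set ℂ}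
    (h : ExtendsContinuously φ φb D Ω) {a : ℂ} (ha : a ∈ closure D) {U V : Set ℂ}
    (hU : U ∈ 𝓝 a) (hV : V ∈ 𝓝 (φb a)) : ∃ u ∈ D, u ∈ U ∧ φ u ∈ V := by
  have : (𝓝[D] a).NeBot := mem_closure_iff_nhdsWithin_neBot.1 ha
  have h1 : Tendsto φb (𝓝[D] a) (𝓝 (φb a)) :=
    (h.1 a ha).mono_left (nhdsWithin_mono _ subset_closure)
  obtain ⟨u, huV, huD, huU⟩ := ((h1.eventually_mem hV).and
    (Filter.Eventually.and self_mem_nhdsWithin (nhdsWithin_le_nhds hU))).exists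
  exact ⟨u, huD, huU, h.2.1 huD ▸ huV⟩

/-- If the boundary of `D` is split by two closed sets whose intersection has connected image,
then that image separates the images of the two pieces within the boundary of `Ω`. -/
theorem ExtendsContinuously.false_of_isPreconnected {φ φb : ℂ → ℂ} {D Ω : Set ℂ}
    (h : ExtendsContinuously φ φb D Ω) (hφ : IsHomeoOnto φ D Ω) (hD : IsOpen D)
    (hDb : Bornology.IsBounded D) (hΩ : IsOpen Ω) (hΩc : IsPreconnected Ω)
    (hΩb : Bornology.IsBounded Ω) {E₁ E₂ : Set ℂ} (hE₁ : IsClosed E₁) (hE₂ : IsClosed E₂)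
    (hE : E₁ ∪ E₂ = frontier D) (hT : IsPreconnected (φb '' (E₁ ∩ E₂))) {a₁ a₂ : ℂ}
    (ha₁ : a₁ ∈ E₁) (ha₁' : a₁ ∉ E₂) (ha₂ : a₂ ∈ E₂) (ha₂' : a₂ ∉ E₁) {C : Set ℂ}
    (hC : IsPreconnected C)
    (hCΩ : C ⊆ frontier Ω) (hCT : Disjoint C (φb '' (E₁ ∩ E₂)))
    (h₁ : φb a₁ ∈ C) (h₂ : φb a₂ ∈ C) : False := by
  obtain ⟨ψ, hψ, hψm, hψφ, hφψ⟩ := hφ.exists_inverse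
  set K := {z | z ∈ closure D ∧ Metric.infDist z E₁ = Metric.infDist z E₂}
  have hc₁ : Continuous fun z => Metric.infDist z E₁ := Metric.continuous_infDist_pt _
  have hc₂ : Continuous fun z => Metric.infDist z E₂ := Metric.continuous_infDist_pt _
  have hKc : IsCompact K := hDb.isCompact_closure.of_isClosed_subset
    (isClosed_closure.inter (isClosed_eq hc₁ hc₂)) fun z hz => hz.1
  have hLc : IsCompact (φb '' K) := hKc.image_of_continuousOn (h.1.mono fun z hz => hz.1)
  have hfc : IsCompact (frontier Ω) := hΩb.isCompact_closure.of_isClosed_subset isClosed_frontier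
    frontier_subset_closure
  have hdΩ : Disjoint Ω (frontier Ω) := Set.disjoint_left.2 fun z hz hzf =>
    (hΩ.frontier_eq ▸ hzf).2 hz
  have hne₁ : E₁.Nonempty := ⟨a₁, ha₁⟩
  have hne₂ : E₂.Nonempty := ⟨a₂, ha₂⟩
  have hcl₁ : E₁ ⊆ closure D := (hE ▸ Set.subset_union_left).trans frontier_subset_closure
  have hcl₂ : E₂ ⊆ closure D := (hE ▸ Set.subset_union_right).trans frontier_subset_closure
  have hint : frontier Ω ∩ φb '' K = φb '' (E₁ ∩ E₂) := by
    apply Set.Subset.antisymm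
    · rintro _ ⟨hz, z, hzK, rfl⟩
      refine ⟨z, ?_, rfl⟩
      have hzD : z ∉ D := fun hzD =>
        Set.disjoint_left.1 hdΩ (hφ.2.1.mapsTo hzD) (h.2.1 hzD ▸ hz)
      have hzf : z ∈ E₁ ∪ E₂ := hE ▸ hD.frontier_eq ▸ ⟨hzK.1, hzD⟩
      have hzK2 := hzK.2
      rcases hzf with hz1 | hz2
      · rw [Metric.infDist_zero_of_mem hz1] at hzK2
        exact ⟨hz1, (hE₂.mem_iff_infDist_zero hne₂).2 hzK2.symm⟩
      · rw [Metric.infDist_zero_of_mem hz2] at hzK2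
        exact ⟨(hE₁.mem_iff_infDist_zero hne₁).2 hzK2, hz2⟩
    · rintro _ ⟨z, ⟨hz1, hz2⟩, rfl⟩
      exact ⟨h.mem_frontier hφ hD hΩ (hE ▸ Or.inl hz1), z, ⟨hcl₁ hz1, by
        rw [Metric.infDist_zero_of_mem hz1, Metric.infDist_zero_of_mem hz2]⟩, rfl⟩
  have hCL : Disjoint C (φb '' K) := Set.disjoint_left.2 fun z hz hzK =>
    Set.disjoint_left.1 hCT hz (hint.subset ⟨hCΩ hz, hzK⟩)
  obtain ⟨ρ₁, hρ₁, hb₁⟩ := Metric.isOpen_iff.1 hLc.isClosed.isOpen_compl (φb a₁)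
    (Set.disjoint_left.1 hCL h₁)
  obtain ⟨ρ₂, hρ₂, hb₂⟩ := Metric.isOpen_iff.1 hLc.isClosed.isOpen_compl (φb a₂)
    (Set.disjoint_left.1 hCL h₂)
  obtain ⟨u₁, hu₁, hlt₁, hv₁⟩ := h.exists_near (hcl₁ ha₁)
    (U := {z | Metric.infDist z E₁ < Metric.infDist z E₂}) ((isOpen_lt hc₁ hc₂).mem_nhds (by
      rw [Set.mem_ofPred_eq, Metric.infDist_zero_of_mem ha₁]
      exact (hE₂.notMem_iff_infDist_pos hne₂).1 ha₁')) (Metric.ball_mem_nhds _ hρ₁)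
  obtain ⟨u₂, hu₂, hlt₂, hv₂⟩ := h.exists_near (hcl₂ ha₂)
    (U := {z | Metric.infDist z E₂ < Metric.infDist z E₁}) ((isOpen_lt hc₂ hc₁).mem_nhds (by
      rw [Set.mem_ofPred_eq, Metric.infDist_zero_of_mem ha₂]
      exact (hE₁.notMem_iff_infDist_pos hne₁).1 ha₂')) (Metric.ball_mem_nhds _ hρ₂)
  have hC' : IsPreconnected (Metric.ball (φb a₁) ρ₁ ∪ (C ∪ Metric.ball (φb a₂) ρ₂)) :=
    IsPreconnected.union (φb a₁) (Metric.mem_ball_self hρ₁) (Or.inl h₁)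
      Metric.isPreconnected_ball
      (IsPreconnected.union (φb a₂) h₂ (Metric.mem_ball_self hρ₂) hC Metric.isPreconnected_ball)
  have hC'd : Disjoint (Metric.ball (φb a₁) ρ₁ ∪ (C ∪ Metric.ball (φb a₂) ρ₂)) (φb '' K) :=
    Set.disjoint_union_left.2 ⟨Set.disjoint_left.2 fun z hz => hb₁ hz,
      Set.disjoint_union_left.2 ⟨hCL, Set.disjoint_left.2 fun z hz => hb₂ hz⟩⟩
  obtain ⟨W, hW, hWd, hvW₁, hvW₂⟩ := exists_isPreconnected_of_union hfc hLc (hint ▸ hT)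
    hΩc hC' hdΩ hC'd (hφ.2.1.mapsTo hu₁) (Or.inl hv₁) (hφ.2.1.mapsTo hu₂) (Or.inr (Or.inr hv₂))
  have hWΩ : W ⊆ Ω := hW.subset_of_disjoint_frontier (hWd.mono_right Set.subset_union_left)
    hvW₁ (hφ.2.1.mapsTo hu₁)
  obtain ⟨u, hu, hu0⟩ := hW.intermediate_value hvW₁ hvW₂
    (((hc₁.sub hc₂).comp_continuousOn (hψ.mono hWΩ) :)) (show (0 : ℝ) ∈ Set.Icc _ _ by
      simp only [Function.comp, hψφ _ hu₁, hψφ _ hu₂]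
      exact ⟨(sub_neg.2 hlt₁).le, (sub_pos.2 hlt₂).le⟩)
  have huD := hψm (hWΩ hu)
  exact Set.disjoint_left.1 hWd hu (Or.inr ⟨ψ u, ⟨subset_closure huD, sub_eq_zero.1 hu0⟩,
    (h.2.1 huD).trans (hφψ u (hWΩ hu))⟩)

theorem ExtendsContinuously.injOn {φ φb : ℂ → ℂ} {D Ω : Set ℂ}
    (h : ExtendsContinuously φ φb D Ω) (hφ : IsHomeoOnto φ D Ω)
    (hD : IsGeneralizedJordanDomain D) (hΩ : IsGeneralizedJordanDomain Ω)
    (harc : ∀ A : Set ℂ, A ⊆ frontier D → IsArc A → ¬ ∃ w : ℂ, ∀ z ∈ A, φb z = w) :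
    Set.InjOn φb (closure D) := by
  have hDo : IsOpen D := hD.1.2.1
  have hΩo : IsOpen Ω := hΩ.1.2.1
  have hbd : ∀ z ∈ frontier D, φb z ∈ frontier Ω := fun z => h.mem_frontier hφ hDo hΩo
  have hfD : ∀ z ∈ closure D, z ∉ D → z ∈ frontier D := fun z hz hzD =>
    hDo.frontier_eq ▸ ⟨hz, hzD⟩
  have hmix : ∀ z₁ ∈ D, ∀ z₂ ∈ closure D, φb z₁ = φb z₂ → z₂ ∈ D := by
    intro z₁ hz₁ z₂ hz₂ heq
    by_contra hn
    have h1 := hbd z₂ (hfD z₂ hz₂ hn)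
    rw [← heq, h.2.1 hz₁, hΩo.frontier_eq] at h1
    exact h1.2 (hφ.2.1.mapsTo hz₁)
  intro z₁ hz₁ z₂ hz₂ heq
  by_cases hz₁D : z₁ ∈ D
  · have hz₂D := hmix z₁ hz₁D z₂ hz₂ heq
    rw [h.2.1 hz₁D, h.2.1 hz₂D] at heq
    exact hφ.2.1.injOn hz₁D hz₂D heq
  have hz₂D : z₂ ∉ D := fun hz₂D => hz₁D (hmix z₂ hz₂D z₁ hz₁ heq.symm)
  by_contra hne
  have hf₁ := hfD z₁ hz₁ hz₁D
  have hf₂ := hfD z₂ hz₂ hz₂D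
  have sep : ∀ {E₁ E₂ : Set ℂ}, IsClosed E₁ → IsClosed E₂ → E₁ ∪ E₂ = frontier D →
      IsPreconnected (φb '' (E₁ ∩ E₂)) → ∀ {a₁ a₂ : ℂ}, a₁ ∈ E₁ → a₁ ∉ E₂ → a₂ ∈ E₂ → a₂ ∉ E₁ →
      ∀ {C : Set ℂ}, IsPreconnected C → C ⊆ frontier Ω → Disjoint C (φb '' (E₁ ∩ E₂)) →
      φb a₁ ∈ C → φb a₂ ∈ C → False := by
    intro E₁ E₂ hE₁ hE₂ hE hT a₁ a₂ ha₁ ha₁' ha₂ ha₂' C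
    exact h.false_of_isPreconnected hφ hDo hD.2.1 hΩo hΩ.1.2.2.isPreconnected hΩ.2.1 hE₁ hE₂ hE hT
      ha₁ ha₁' ha₂ ha₂'
  by_cases hcomp : z₂ ∈ connectedComponentIn (frontier D) z₁
  swap
  · obtain ⟨F₁, F₂, hF₁, hF₂, hU, hI, h1, h2⟩ :=
      exists_isClosed_disjoint_cover hD.2.2.1.1 hf₁ hf₂ hcomp
    have hd : Disjoint F₁ F₂ := Set.disjoint_iff_inter_eq_empty.2 hI
    refine sep hF₁ hF₂ hU ?_ h1 (Set.disjoint_left.1 hd h1) h2 (Set.disjoint_right.1 hd h2)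
      (C := {φb z₁}) isPreconnected_singleton (Set.singleton_subset_iff.2 (hbd z₁ hf₁)) ?_ rfl
      heq.symm
    · rw [hI, Set.image_empty]
      exact isPreconnected_empty
    · rw [hI, Set.image_empty]
      exact Set.disjoint_empty _
  have hQJ : IsJordanCurve (connectedComponentIn (frontier D) z₁) :=
    (hD.2.2.2 z₁ hf₁).resolve_left fun hs => hne (by rw [hs] at hcomp; exact hcomp.symm)
  obtain ⟨Q₁, Q₂, hA₁, hA₂, hQ, hQI⟩ := hQJ.exists_arcs (mem_connectedComponentIn hf₁) hcomp hne
  have hQD : Q₁ ∪ Q₂ ⊆ frontier D := hQ ▸ connectedComponentIn_subset _ _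
  obtain ⟨E₁, E₂, hE₁, hE₂, hU, hI, h1, h2, -⟩ := hD.2.2.1.exists_isClosed_cover hf₁ hA₁.isClosed
    hA₂.isClosed hQ isClosed_empty (Set.empty_disjoint Q₂)
  have hTw : φb '' (E₁ ∩ E₂) = {φb z₁} := by
    rw [hI, hQI, Set.image_pair, heq, Set.pair_eq_singleton]
  have hA₁' := harc Q₁ (Set.subset_union_left.trans hQD) hA₁
  have hA₂' := harc Q₂ (Set.subset_union_right.trans hQD) hA₂
  push Not at hA₁' hA₂'
  obtain ⟨a₁, ha₁, hw₁⟩ := hA₁' (φb z₁)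
  obtain ⟨a₂, ha₂, hw₂⟩ := hA₂' (φb z₁)
  have hpre : IsPreconnected (φb '' connectedComponentIn (frontier D) z₁) :=
    isPreconnected_connectedComponentIn.image _
      (h.1.mono ((connectedComponentIn_subset _ _).trans frontier_subset_closure))
  have hsub : φb '' connectedComponentIn (frontier D) z₁ ⊆
      connectedComponentIn (frontier Ω) (φb z₁) :=
    hpre.subset_connectedComponentIn ⟨z₁, mem_connectedComponentIn hf₁, rfl⟩ (by
      rintro _ ⟨z, hz, rfl⟩
      exact hbd z (connectedComponentIn_subset _ _ hz))
  have hP₁ := hsub ⟨a₁, hQ ▸ Or.inl ha₁, rfl⟩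
  have hP₂ := hsub ⟨a₂, hQ ▸ Or.inr ha₂, rfl⟩
  have hPJ : IsJordanCurve (connectedComponentIn (frontier Ω) (φb z₁)) :=
    (hΩ.2.2.2 _ (hbd z₁ hf₁)).resolve_left fun hs => hw₁ (by rw [hs] at hP₁; exact hP₁)
  have hnotT : ∀ a, φb a ≠ φb z₁ → a ∉ E₁ ∩ E₂ := fun a ha haE => by
    have : φb a ∈ φb '' (E₁ ∩ E₂) := ⟨a, haE, rfl⟩
    rw [hTw] at this
    exact ha this
  refine sep hE₁ hE₂ hU ?_ (h1 ha₁) (fun hn => hnotT a₁ hw₁ ⟨h1 ha₁, hn⟩) (h2 ha₂)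
    (fun hn => hnotT a₂ hw₂ ⟨hn, h2 ha₂⟩)
    (hPJ.isPreconnected_diff_singleton (mem_connectedComponentIn (hbd z₁ hf₁)))
    (Set.sdiff_subset.trans (connectedComponentIn_subset _ _)) ?_ ⟨hP₁, hw₁⟩ ⟨hP₂, hw₂⟩
  · rw [hTw]
    exact isPreconnected_singleton
  · rw [hTw]
    exact Set.disjoint_sdiff_left

/-! ### Boundaries under homeomorphic extensions -/

theorem IsCompact.nonempty_homeomorph_image {X Y : Type*} [TopologicalSpace X]
    [TopologicalSpace Y] [T2Space Y] {K : Set X} (hK : IsCompact K) {f : X → Y}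
    (hf : ContinuousOn f K) (hi : Set.InjOn f K) :
    ∃ e : K ≃ₜ f '' K, ∀ x : K, (e x : Y) = f x := by
  have : CompactSpace K := isCompact_iff_compactSpace.1 hK
  set e : K ≃ f '' K := Equiv.Set.imageOfInjOn f K hi
  have he : Continuous e := Continuous.subtype_mk (continuousOn_iff_continuous_domRestrict.1 hf) _
  exact ⟨he.homeoOfEquivCompactToT2, fun x => rfl⟩

theorem IsCompact.connectedComponentIn_image {X Y : Type*} [TopologicalSpace X]
    [TopologicalSpace Y] [T2Space Y] {K : Set X} (hK : IsCompact K) {f : X → Y}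
    (hf : ContinuousOn f K) (hi : Set.InjOn f K) {x : X} (hx : x ∈ K) :
    connectedComponentIn (f '' K) (f x) = f '' connectedComponentIn K x := by
  obtain ⟨e, he⟩ := hK.nonempty_homeomorph_image hf hi
  have h1 := e.image_connectedComponentIn (Set.mem_univ (⟨x, hx⟩ : K))
  rw [Set.image_univ, e.surjective.range_eq, connectedComponentIn_univ, connectedComponentIn_univ,
    show e ⟨x, hx⟩ = ⟨f x, Set.mem_image_of_mem f hx⟩ from Subtype.ext (he _)] at h1
  rw [connectedComponentIn_eq_image (Set.mem_image_of_mem f hx), ← h1,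
    connectedComponentIn_eq_image hx, Set.image_image, Set.image_image]
  exact Set.image_congr fun y _ => he y

theorem IsCompact.connectedComponentIn {X : Type*} [TopologicalSpace X] {K : Set X}
    (hK : IsCompact K) {x : X} : IsCompact (connectedComponentIn K x) := by
  by_cases hx : x ∈ K
  · have : CompactSpace K := isCompact_iff_compactSpace.1 hK
    rw [connectedComponentIn_eq_image hx]
    exact isClosed_connectedComponent.isCompact.image continuous_subtype_val
  · rw [connectedComponentIn_eq_empty hx]
    exact isCompact_empty

theorem IsPeanoCompactum.image {K : Set ℂ} (hK : IsPeanoCompactum K) {f : ℂ → ℂ}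
    (hf : ContinuousOn f K) (hi : Set.InjOn f K) : IsPeanoCompactum (f '' K) := by
  obtain ⟨hKc, hloc, hnull⟩ := hK
  refine ⟨hKc.image_of_continuousOn hf, ?_, fun C hC => ?_⟩
  · rintro _ ⟨x, hx, rfl⟩
    rw [hKc.connectedComponentIn_image hf hi hx]
    have hsub := connectedComponentIn_subset K x
    obtain ⟨e, -⟩ :=
      hKc.connectedComponentIn.nonempty_homeomorph_image (hf.mono hsub) (hi.mono hsub)
    have := hloc x hx
    exact e.symm.isOpenEmbedding.locallyConnectedSpace
  · obtain ⟨δ, hδ, huc⟩ := Metric.uniformContinuousOn_iff.1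
      (hKc.uniformContinuousOn_of_continuous hf) C hC
    refine ((hnull (δ / 2) (half_pos hδ)).image (fun Q => f '' Q)).subset ?_
    rintro _ ⟨⟨_, ⟨x, hx, rfl⟩, rfl⟩, hd⟩
    rw [hKc.connectedComponentIn_image hf hi hx] at hd ⊢
    refine ⟨_, ⟨⟨x, hx, rfl⟩, ?_⟩, rfl⟩
    by_contra! hle
    refine absurd hd (not_lt.2 (Metric.diam_le_of_forall_dist_le hC.le ?_))
    rintro _ ⟨a, ha, rfl⟩ _ ⟨b, hb, rfl⟩
    have hsub := connectedComponentIn_subset K x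
    refine (huc a (hsub ha) b (hsub hb) ?_).le
    have := Metric.dist_le_diam_of_mem (hKc.isBounded.subset hsub) ha hb
    linarith

theorem ExtendsContinuously.isGeneralizedJordanDomain {φ φb : ℂ → ℂ} {D Ω : Set ℂ}
    (h : ExtendsContinuously φ φb D Ω) (hinj : Set.InjOn φb (closure D)) (hφ : IsHomeoOnto φ D Ω)
    (hD : IsGeneralizedJordanDomain D) (hΩ : IsPlanarDomain Ω) (hΩb : Bornology.IsBounded Ω) :
    IsGeneralizedJordanDomain Ω := by
  have hcl : closure Ω ⊆ φb '' closure D := by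
    refine closure_minimal ?_ (hD.2.1.isCompact_closure.image_of_continuousOn h.1).isClosed
    intro w hw
    obtain ⟨z, hz, rfl⟩ := hφ.2.1.surjOn hw
    exact ⟨z, subset_closure hz, h.2.1 hz⟩
  have hfr : φb '' frontier D = frontier Ω := by
    apply Set.Subset.antisymm
    · rintro _ ⟨z, hz, rfl⟩
      exact h.mem_frontier hφ hD.1.2.1 hΩ.2.1 hz
    · intro w hw
      obtain ⟨z, hz, rfl⟩ := hcl (frontier_subset_closure hw)
      refine ⟨z, ?_, rfl⟩
      rw [hD.1.2.1.frontier_eq]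
      refine ⟨hz, fun hzD => ?_⟩
      rw [h.2.1 hzD, hΩ.2.1.frontier_eq] at hw
      exact hw.2 (hφ.2.1.mapsTo hzD)
  have hf : ContinuousOn φb (frontier D) := h.1.mono frontier_subset_closure
  have hi : Set.InjOn φb (frontier D) := hinj.mono frontier_subset_closure
  have hc := hD.2.2.1.1
  refine ⟨hΩ, hΩb, hfr ▸ hD.2.2.1.image hf hi, ?_⟩
  rw [← hfr]
  rintro _ ⟨z, hz, rfl⟩
  rw [hc.connectedComponentIn_image hf hi hz]
  rcases hD.2.2.2 z hz with hs | ⟨⟨e⟩⟩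
  · left
    rw [hs, Set.image_singleton]
  · right
    have hsub := connectedComponentIn_subset (frontier D) z
    obtain ⟨e', -⟩ :=
      hc.connectedComponentIn.nonempty_homeomorph_image (hf.mono hsub) (hi.mono hsub)
    exact ⟨e'.symm.trans e⟩

theorem ExtendsContinuously.oscLiminfZero {φ φb : ℂ → ℂ} {D Ω : Set ℂ}
    (h : ExtendsContinuously φ φb D Ω) (hD : Bornology.IsBounded D) (z₀ : ℂ) :
    OscLiminfZero φ D z₀ := by
  refine Filter.Tendsto.liminf_eq ?_
  rw [Metric.tendsto_nhdsWithin_nhds]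
  intro ε hε
  obtain ⟨δ, hδ, huc⟩ := Metric.uniformContinuousOn_iff.1
    (hD.isCompact_closure.uniformContinuousOn_of_continuous h.1) (ε / 2) (half_pos hε)
  refine ⟨δ / 2, half_pos hδ, fun {r} hr hrδ => ?_⟩
  rw [Real.dist_0_eq_abs, abs_of_pos hr] at hrδ
  rw [Real.dist_0_eq_abs, oscDiam, abs_of_nonneg Metric.diam_nonneg]
  refine lt_of_le_of_lt (Metric.diam_le_of_forall_dist_le (half_pos hε).le ?_) (half_lt_self hε)
  rintro _ ⟨a, ⟨ha, har⟩, rfl⟩ _ ⟨b, ⟨hb, hbr⟩, rfl⟩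
  rw [← h.2.1 ha, ← h.2.1 hb]
  refine (huc a (subset_closure ha) b (subset_closure hb) ?_).le
  have h1 := dist_triangle_right a b z₀
  rw [Metric.mem_sphere.1 har, Metric.mem_sphere.1 hbr] at h1
  linarith

theorem ExtendsContinuously.eqOn {φ φb φb' : ℂ → ℂ} {D Ω : Set ℂ}
    (h : ExtendsContinuously φ φb D Ω) (h' : ExtendsContinuously φ φb' D Ω) :
    Set.EqOn φb φb' (closure D) :=
  Set.EqOn.of_subset_closure (h.2.1.trans h'.2.1.symm) h.1 h'.1 subset_closure subset_rfl

/-- Theorem B (topological Osgood–Taylor–Carathéodory theorem). -/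
theorem stmt_1 (D Ω : Set ℂ) (φ : ℂ → ℂ)
    (hD : IsGeneralizedJordanDomain D)
    (hΩ : IsPlanarDomain Ω) (hΩb : Bornology.IsBounded Ω)
    (hφ : IsHomeoOnto φ D Ω) :
    (∃ φb : ℂ → ℂ, ExtendsContinuously φ φb D Ω ∧ Set.InjOn φb (closure D)) ↔
      (IsGeneralizedJordanDomain Ω ∧
       (∀ z₀ ∈ frontier D, OscLiminfZero φ D z₀) ∧
       (∀ φb : ℂ → ℂ, ExtendsContinuously φ φb D Ω →
         ∀ A : Set ℂ, A ⊆ frontier D → IsArc A → 0 < μH[1] A →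
           ¬ ∃ w : ℂ, ∀ z ∈ A, φb z = w)) := by
  constructor
  · rintro ⟨φb, h, hinj⟩
    refine ⟨h.isGeneralizedJordanDomain hinj hφ hD hΩ hΩb,
      fun z₀ _ => h.oscLiminfZero hD.2.1 z₀, ?_⟩
    rintro φb' h' A hA harc - ⟨w, hw⟩
    obtain ⟨a, ha, b, hb, hab⟩ := harc.exists_ne
    have hAc := hA.trans frontier_subset_closure
    refine hab (hinj (hAc ha) (hAc hb) ?_)
    rw [h.eqOn h' (hAc ha), h.eqOn h' (hAc hb), hw a ha, hw b hb]
  · rintro ⟨hΩJ, hosc, harc⟩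
    obtain ⟨φb, h⟩ := hφ.exists_extendsContinuously hD.1.2.1 hΩJ hosc
    exact ⟨φb, h, h.injOn hφ hD hΩJ fun A hA hArc => harc φb h A hA hArc hArc.hausdorffMeasure_pos⟩
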